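/- arXiv:2108.06724 — 2 statements merged into one kernel-verified Lean document; each statement's English description precedes it below -/
import Mathlib

section
/- Let f : G → G be a graph map and x ∈ G such that ω_f(x) is a solenoid. If (Y_n) is any sequence of cycles of graphs with periods (m_n) such that Y_{n+1} ⊆ Y_n, ω_f(x) ⊆ Y_n for all n, and m_n → ∞, then ⋂_{n≥1} Y_n equals the intersection of all cycles of graphs containing ω_f(x); in particular ⋂_{n≥1} Y_n does not depend on the choice of such a sequence. -/
open Set Filter Topology

/-- An arc in `X` with endpoints `a` and `b`: the image of a continuous injection
of `[0,1]` sending `0` to `a` and `1` to `b`. -/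
def IsArcWithEnds {X : Type*} [TopologicalSpace X] (A : Set X) (a b : X) : Prop :=
  ∃ φ : Set.Icc (0:ℝ) 1 → X, Continuous φ ∧ Function.Injective φ ∧
    Set.range φ = A ∧ φ ⟨0, by norm_num⟩ = a ∧ φ ⟨1, by norm_num⟩ = b

/-- A topological graph: a compact connected (metrizable) space which is a union of
finitely many arcs, any two of which are either disjoint or intersect in exactly one
common endpoint. -/
def IsTopGraph (X : Type*) [TopologicalSpace X] : Prop :=
  CompactSpace X ∧ ConnectedSpace X ∧
  ∃ (n : ℕ) (A : Fin n → Set X) (a b : Fin n → X),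
    (∀ i, IsArcWithEnds (A i) (a i) (b i)) ∧
    (⋃ i, A i) = Set.univ ∧
    ∀ i j, i ≠ j →
      A i ∩ A j = ∅ ∨
      ∃ p, A i ∩ A j = {p} ∧ p ∈ ({a i, b i} : Set X) ∧ p ∈ ({a j, b j} : Set X)

/-- A subgraph of `G`: a closed connected subset which is itself a topological graph. -/
def IsSubgraph {G : Type*} [TopologicalSpace G] (K : Set G) : Prop :=
  IsClosed K ∧ IsConnected K ∧ IsTopGraph ↥K

/-- A periodic subgraph with period `k`: `K, f(K), …, f^{k−1}(K)` are pairwise disjoint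
and `f^k(K) = K`. -/
def IsPeriodicSubgraph {G : Type*} [TopologicalSpace G] (f : G → G) (K : Set G) (k : ℕ) :
    Prop :=
  IsSubgraph K ∧ 0 < k ∧ f^[k] '' K = K ∧
    ∀ i j, i < k → j < k → i ≠ j → Disjoint (f^[i] '' K) (f^[j] '' K)

/-- A cycle of graphs with period `k`: the orbit `⋃_{i<k} f^i(K)` of a periodic
subgraph `K` with period `k`. -/
def IsCycleOfGraphs {G : Type*} [TopologicalSpace G] (f : G → G) (X : Set G) (k : ℕ) :
    Prop :=
  ∃ K, IsPeriodicSubgraph f K k ∧ X = ⋃ i ∈ Finset.range k, f^[i] '' K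

/-- The ω-limit set of `x` under `f`. -/
def omegaSet {G : Type*} [TopologicalSpace G] (f : G → G) (x : G) : Set G :=
  ⋂ n : ℕ, closure ((fun m => f^[m] x) '' Set.Ici n)

/-- `ω(f) = ⋃_{x} ω_f(x)`. -/
def omegaUnion {G : Type*} [TopologicalSpace G] (f : G → G) : Set G :=
  ⋃ x, omegaSet f x

/-- A set `W` is a solenoid for `f` if it is infinite and is contained in cycles of
graphs of arbitrarily large periods. -/
def IsSolenoid {G : Type*} [TopologicalSpace G] (f : G → G) (W : Set G) : Prop :=
  W.Infinite ∧ ∀ n : ℕ, ∃ X k, n ≤ k ∧ IsCycleOfGraphs f X k ∧ W ⊆ X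

/-- Two points are separable if they belong to two disjoint periodic subgraphs. -/
def SeparablePoints {G : Type*} [TopologicalSpace G] (f : G → G) (x y : G) : Prop :=
  ∃ I J kI kJ, IsPeriodicSubgraph f I kI ∧ IsPeriodicSubgraph f J kJ ∧
    Disjoint I J ∧ x ∈ I ∧ y ∈ J

/-- An NS-pair: a pair of distinct points of `ω(f)` contained in a nested sequence of
periodic subgraphs whose periods tend to infinity. -/
def IsNSPair {G : Type*} [TopologicalSpace G] (f : G → G) (x y : G) : Prop :=
  x ≠ y ∧ x ∈ omegaUnion f ∧ y ∈ omegaUnion f ∧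
  ∃ (J : ℕ → Set G) (m : ℕ → ℕ),
    (∀ n, IsPeriodicSubgraph f (J n) (m n)) ∧
    (∀ n, J (n + 1) ⊆ J n) ∧
    Filter.Tendsto m Filter.atTop Filter.atTop ∧
    ∀ n, x ∈ J n ∧ y ∈ J n

/-- The pair `⟨x,y⟩` is proximal. -/
def Proximal {G : Type*} [PseudoMetricSpace G] (f : G → G) (x y : G) : Prop :=
  ∀ ε > (0 : ℝ), ∀ N : ℕ, ∃ n ≥ N, dist (f^[n] x) (f^[n] y) < ε

/-- The pair `⟨x,y⟩` is asymptotic. -/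
def Asymptotic {G : Type*} [PseudoMetricSpace G] (f : G → G) (x y : G) : Prop :=
  Filter.Tendsto (fun n => dist (f^[n] x) (f^[n] y)) Filter.atTop (nhds 0)

/-- A scrambled pair is proximal but not asymptotic. -/
def ScrambledPair {G : Type*} [PseudoMetricSpace G] (f : G → G) (x y : G) : Prop :=
  Proximal f x y ∧ ¬ Asymptotic f x y

/-- Li–Yorke chaos: existence of an uncountable scrambled set. -/
def LiYorkeChaotic {G : Type*} [PseudoMetricSpace G] (f : G → G) : Prop :=
  ∃ S : Set G, ¬ S.Countable ∧ ∀ x ∈ S, ∀ y ∈ S, x ≠ y → ScrambledPair f x y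

/-- `I ⊆ ℕ` is an independence set for the pair of sets `{A, B}`. -/
def IsIndepSet {G : Type*} (f : G → G) (A B : Set G) (I : Set ℕ) : Prop :=
  ∀ J : Finset ℕ, ↑J ⊆ I → J.Nonempty → ∀ S : ℕ → Bool,
    (⋂ i ∈ J, f^[i] ⁻¹' (if S i then A else B)).Nonempty

/-- An IN-pair: every pair of neighborhoods has arbitrarily large finite
independence sets. -/
def IsINPair {G : Type*} [TopologicalSpace G] (f : G → G) (x y : G) : Prop :=
  ∀ U V : Set G, U ∈ nhds x → V ∈ nhds y →
    ∀ n : ℕ, ∃ I : Finset ℕ, n ≤ I.card ∧ IsIndepSet f U V ↑I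

/-- An IT-pair: every pair of neighborhoods has an infinite independence set. -/
def IsITPair {G : Type*} [TopologicalSpace G] (f : G → G) (x y : G) : Prop :=
  ∀ U V : Set G, U ∈ nhds x → V ∈ nhds y →
    ∃ I : Set ℕ, I.Infinite ∧ IsIndepSet f U V I

/-- The set of periodic points of `f`. -/
def PerPts {G : Type*} (f : G → G) : Set G :=
  {p | ∃ n ≥ 1, f^[n] p = p}

/-- A closed connected set has finitely many boundary points in the interior of a parametrized
arc whose open subintervals are open in the ambient space. -/
lemma finite_preimage_frontier_of_isPreconnected {X : Type*} [TopologicalSpace X] [T2Space X]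
    {φ : Set.Icc (0:ℝ) 1 → X} (hφ : Continuous φ) (hinj : Function.Injective φ)
    (hopen : ∀ s t, IsOpen (φ '' Ioo s t)) {K : Set X} (hK : IsClosed K)
    (hconn : IsPreconnected K) : (φ ⁻¹' frontier K ∩ Ioo 0 1).Finite := by
  have key : ∀ s t, φ s ∉ K → φ t ∉ K → ∀ q ∈ Ioo s t, φ q ∈ K →
      ∀ p, φ p ∈ K → p ∈ Ioo s t := by
    intro s t hs ht q hq hqK p hp
    have hC : IsClosed (φ '' Icc s t) := (isCompact_Icc.image hφ).isClosed
    have hsub : K ⊆ φ '' Ioo s t := by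
      refine hconn.subset_left_of_subset_union (hopen s t) hC.isOpen_compl
        (disjoint_compl_right_iff_subset.2 (image_mono Ioo_subset_Icc_self)) ?_
        ⟨φ q, hqK, q, hq, rfl⟩
      intro y hy
      by_cases hyC : y ∈ φ '' Icc s t
      · obtain ⟨u, hu, rfl⟩ := hyC
        refine Or.inl ⟨u, ⟨hu.1.lt_of_ne ?_, hu.2.lt_of_ne ?_⟩, rfl⟩
        · rintro rfl; exact hs hy
        · rintro rfl; exact ht hy
      · exact Or.inr hyC
    exact hinj.mem_set_image.1 (hsub hp)
  have near : ∀ p, φ p ∈ frontier K → ∀ u v, p ∈ Ioo u v → ∃ p' ∈ Ioo u v, φ p' ∉ K := by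
    intro p hp u v hpuv
    rw [frontier_eq_closure_inter_closure] at hp
    obtain ⟨_, ⟨p', hp', rfl⟩, hp'K⟩ :=
      mem_closure_iff.1 hp.2 _ (hopen u v) ⟨p, hpuv, rfl⟩
    exact ⟨p', hp', hp'K⟩
  refine Set.finite_of_forall_not_lt_lt ?_
  rintro p ⟨hp, hp01⟩ q ⟨hq, -⟩ r ⟨hr, hr01⟩ hpq hqr
  obtain ⟨p', hp', hp'K⟩ := near p hp 0 q ⟨hp01.1, hpq⟩
  obtain ⟨q', hq', hq'K⟩ := near q hq p r ⟨hpq, hqr⟩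
  obtain ⟨r', hr', hr'K⟩ := near r hr q 1 ⟨hqr, hr01.2⟩
  have hrr' : r < r' :=
    (key p' r' hp'K hr'K q ⟨hp'.2, hr'.1⟩ (hK.frontier_subset hq) r (hK.frontier_subset hr)).2
  exact lt_asymm hq'.1
    (key q' r' hq'K hr'K r ⟨hq'.2, hrr'⟩ (hK.frontier_subset hr) p (hK.frontier_subset hp)).1

/-- In a topological graph, closed connected sets have finite boundary. -/
lemma IsTopGraph.finite_frontier {X : Type*} [TopologicalSpace X] [T2Space X]
    (hX : IsTopGraph X) {K : Set X} (hK : IsClosed K) (hconn : IsPreconnected K) :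
    (frontier K).Finite := by
  obtain ⟨-, -, n, A, a, b, hA, hcover, hinter⟩ := hX
  choose φ hφ hinj hrange h0 h1 using hA
  have hclosed : ∀ i, IsClosed (A i) := fun i => by
    rw [← hrange i]; exact (isCompact_range (hφ i)).isClosed
  have hopen : ∀ i s t, IsOpen (φ i '' Ioo s t) := by
    intro i s t
    have hc : IsClosed (φ i '' (Ioo s t)ᶜ ∪ ⋃ j ∈ {j | j ≠ i}, A j) :=
      ((isOpen_Ioo.isClosed_compl.isCompact.image (hφ i)).isClosed).union
        ((Set.toFinite _).isClosed_biUnion fun j _ => hclosed j)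
    rw [← isClosed_compl_iff]
    convert hc using 1
    ext y
    constructor
    · intro hy
      obtain ⟨j, hj⟩ := mem_iUnion.1 (hcover.ge (mem_univ y))
      by_cases hji : j = i
      · subst hji
        rw [← hrange j] at hj
        obtain ⟨u, rfl⟩ := hj
        exact Or.inl ⟨u, fun hu => hy ⟨u, hu, rfl⟩, rfl⟩
      · exact Or.inr (mem_biUnion (s := {j | j ≠ i}) hji hj)
    · rintro hy ⟨u, hu, rfl⟩
      rcases hy with ⟨v, hv, hvu⟩ | hy
      · exact hv (hinj i hvu ▸ hu)
      · obtain ⟨j, hji, hj⟩ := mem_iUnion₂.1 hy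
        have hi : φ i u ∈ A i := by rw [← hrange i]; exact mem_range_self u
        rcases hinter j i hji with he | ⟨p, hp, -, hpi⟩
        · exact (he.le ⟨hj, hi⟩).elim
        · have hup : φ i u = p := hp.le ⟨hj, hi⟩
          rcases hpi with hpa | hpb
          · have : u = ⟨0, by norm_num⟩ := hinj i (by rw [hup, hpa, h0])
            exact not_lt_of_ge s.2.1 (this ▸ hu).1
          · have : u = ⟨1, by norm_num⟩ :=
              hinj i (by rw [hup, mem_singleton_iff.1 hpb, h1])
            exact not_lt_of_ge t.2.2 (this ▸ hu).2
  have hfin : (⋃ i, φ i '' ((φ i ⁻¹' frontier K ∩ Ioo 0 1) ∪ {0, 1})).Finite :=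
    Set.finite_iUnion fun i => ((finite_preimage_frontier_of_isPreconnected (hφ i) (hinj i)
      (hopen i) hK hconn).union (Set.toFinite _)).image _
  refine hfin.subset fun y hy => ?_
  obtain ⟨i, hi⟩ := mem_iUnion.1 (hcover.ge (mem_univ y))
  rw [← hrange i] at hi
  obtain ⟨u, rfl⟩ := hi
  refine mem_iUnion.2 ⟨i, u, ?_, rfl⟩
  by_cases hu0 : u = 0
  · exact Or.inr (Or.inl hu0)
  by_cases hu1 : u = 1
  · exact Or.inr (Or.inr hu1)
  exact Or.inl ⟨hy, lt_of_le_of_ne u.2.1 (Ne.symm hu0), lt_of_le_of_ne u.2.2 hu1⟩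

/-- A preconnected set meeting both a set and its complement meets the boundary of that set. -/
lemma IsPreconnected.inter_frontier_nonempty {X : Type*} [TopologicalSpace X] {C Z : Set X}
    (hC : IsPreconnected C) (hZ : (C ∩ Z).Nonempty) (hZc : (C ∩ Zᶜ).Nonempty) :
    (C ∩ frontier Z).Nonempty := by
  by_contra hemp
  obtain ⟨w, hwC, hwZ⟩ := hZ
  obtain ⟨v, hvC, hvZ⟩ := hZc
  have hint : ∀ y ∈ C, y ∈ closure Z → y ∈ interior Z := fun y hyC hyZ =>
    by_contra fun hyi => hemp ⟨y, hyC, hyZ, hyi⟩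
  refine hvZ (interior_subset (hC.subset_left_of_subset_union isOpen_interior
    isClosed_closure.isOpen_compl (disjoint_compl_right_iff_subset.2
      (interior_subset.trans subset_closure)) (fun y hyC => ?_)
    ⟨w, hwC, hint w hwC (subset_closure hwZ)⟩ hvC))
  by_cases hy : y ∈ closure Z
  · exact Or.inl (hint y hyC hy)
  · exact Or.inr hy

lemma Set.Finite.frontier_biUnion {X ι : Type*} [TopologicalSpace X] (s : Finset ι)
    {A : ι → Set X} (h : ∀ i ∈ s, (frontier (A i)).Finite) :
    (frontier (⋃ i ∈ s, A i)).Finite := by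
  classical
  induction s using Finset.induction_on with
  | empty => simp
  | insert i s _ ih =>
    rw [Finset.set_biUnion_insert]
    refine ((h i (Finset.mem_insert_self i s)).union
      (ih fun j hj => h j (Finset.mem_insert_of_mem hj))).subset ?_
    exact (frontier_union_subset _ _).trans
      (union_subset_union inter_subset_left inter_subset_right)

lemma omegaSet_mapsTo {G : Type*} [TopologicalSpace G] {f : G → G} (hf : Continuous f) (x : G) :
    MapsTo f (omegaSet f x) (omegaSet f x) := by
  intro y hy
  refine mem_iInter.2 fun n => ?_
  refine map_mem_closure hf (mem_iInter.1 hy n) ?_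
  rintro _ ⟨i, hi, rfl⟩
  exact ⟨i + 1, le_trans hi (Nat.le_succ i), Function.iterate_succ_apply' f i x⟩

lemma image_iterate_add_of_image_eq {α : Type*} {f : α → α} {K : Set α} {m : ℕ}
    (h : f^[m] '' K = K) (i : ℕ) : f^[i + m] '' K = f^[i] '' K := by
  rw [Function.iterate_add, image_comp, h]

namespace IsCycleOfGraphs

variable {G : Type*} {f : G → G} {Y Z : Set G} {m k : ℕ}

lemma mapsTo [TopologicalSpace G] (hZ : IsCycleOfGraphs f Z k) : MapsTo f Z Z := by
  obtain ⟨L, ⟨-, hk, hL, -⟩, rfl⟩ := hZ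
  intro z hz
  simp only [mem_iUnion, Finset.mem_range] at hz ⊢
  obtain ⟨i, hi, y, hy, rfl⟩ := hz
  rw [← Function.iterate_succ_apply' f i y]
  rcases Nat.lt_or_ge (i + 1) k with h | h
  · exact ⟨i + 1, h, y, hy, rfl⟩
  · obtain rfl : i + 1 = k := by omega
    exact ⟨0, hk, _, hL.le ⟨y, hy, rfl⟩, rfl⟩

lemma finite_frontier [TopologicalSpace G] [T2Space G] (hG : IsTopGraph G) (hf : Continuous f)
    (hZ : IsCycleOfGraphs f Z k) : (frontier Z).Finite := by
  obtain ⟨L, ⟨⟨hcl, hconn, -⟩, -⟩, rfl⟩ := hZ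
  have := hG.1
  exact Set.Finite.frontier_biUnion _ fun i _ => hG.finite_frontier
    (hcl.isCompact.image (hf.iterate i)).isClosed
    (hconn.isPreconnected.image _ (hf.iterate i).continuousOn)

/-- A cycle of graphs sharing a nonempty forward invariant set with a forward invariant set `Z`
is contained in `Z` as soon as its period exceeds the number of boundary points of `Z`. -/
lemma subset_of_ncard_frontier_lt [TopologicalSpace G] (hf : Continuous f)
    (hY : IsCycleOfGraphs f Y m) (hZ : MapsTo f Z Z) (hfin : (frontier Z).Finite)
    (hlt : (frontier Z).ncard < m) {W : Set G} (hW : MapsTo f W W) (hne : W.Nonempty)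
    (hWY : W ⊆ Y) (hWZ : W ⊆ Z) : Y ⊆ Z := by
  obtain ⟨K, ⟨⟨-, hconn, -⟩, -, hK, hdisj⟩, rfl⟩ := hY
  have shift : ∀ i < m, ∀ j, f^[j + m - i] '' (f^[i] '' K) = f^[j] '' K := by
    intro i hi j
    rw [← image_comp, ← Function.iterate_add, Nat.sub_add_cancel (by omega),
      image_iterate_add_of_image_eq hK]
  have hmeet : ∀ j, (f^[j] '' K ∩ W).Nonempty := by
    intro j
    obtain ⟨w, hw⟩ := hne
    have hwY := hWY hw
    simp only [mem_iUnion, Finset.mem_range] at hwY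
    obtain ⟨i, hi, hwi⟩ := hwY
    exact ⟨f^[j + m - i] w, (shift i hi j).le ⟨w, hwi, rfl⟩, hW.iterate _ hw⟩
  have hexists : ∃ i < m, f^[i] '' K ⊆ Z := by
    by_contra! hnot
    have hpt : ∀ i : Fin m, ∃ y : frontier Z, (y : G) ∈ f^[i] '' K := by
      intro i
      obtain ⟨w, hwK, hwW⟩ := hmeet i
      obtain ⟨v, hvK, hvZ⟩ := not_subset.1 (hnot i i.2)
      obtain ⟨y, hyK, hy⟩ := IsPreconnected.inter_frontier_nonempty
        (hconn.isPreconnected.image _ (hf.iterate i).continuousOn)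
        ⟨w, hwK, hWZ hwW⟩ ⟨v, hvK, hvZ⟩
      exact ⟨⟨y, hy⟩, hyK⟩
    choose y hy using hpt
    have hyinj : Function.Injective y := by
      intro i j hij
      by_contra hne'
      exact disjoint_left.1 (hdisj i j i.2 j.2 fun h => hne' (Fin.ext h)) (hy i) (hij ▸ hy j)
    have := hfin.to_subtype
    have hcard := Nat.card_le_card_of_injective y hyinj
    rw [Nat.card_fin, Nat.card_coe_set_eq] at hcard
    omega
  obtain ⟨i, hi, hiZ⟩ := hexists
  refine iUnion₂_subset fun j _ => ?_
  rw [← shift i hi j]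
  exact ((hZ.iterate _).mono_left hiZ).image_subset

end IsCycleOfGraphs

/-- If `ω_f(x)` is a solenoid and `(Y_n)` is any nested sequence of cycles of graphs
containing `ω_f(x)` whose periods tend to infinity, then `⋂_n Y_n` equals the
intersection of all cycles of graphs containing `ω_f(x)`. -/
theorem iInter_cycles_eq_sInter {G : Type*} [MetricSpace G]
    (hG : IsTopGraph G) (f : G → G) (hf : Continuous f) (x : G)
    (hsol : IsSolenoid f (omegaSet f x))
    (Y : ℕ → Set G) (m : ℕ → ℕ)
    (hY : ∀ n, IsCycleOfGraphs f (Y n) (m n))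
    (hnest : ∀ n, Y (n + 1) ⊆ Y n)
    (hsub : ∀ n, omegaSet f x ⊆ Y n)
    (hm : Filter.Tendsto m Filter.atTop Filter.atTop) :
    ⋂ n, Y n = ⋂₀ {Z : Set G | ∃ k, IsCycleOfGraphs f Z k ∧ omegaSet f x ⊆ Z} := by
  refine Subset.antisymm (fun p hp => ?_) fun p hp => ?_
  · rintro Z ⟨k, hZ, hWZ⟩
    obtain ⟨n, hn⟩ := (hm.eventually_gt_atTop (frontier Z).ncard).exists
    exact (hY n).subset_of_ncard_frontier_lt hf hZ.mapsTo (hZ.finite_frontier hG hf) hn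
      (omegaSet_mapsTo hf x) hsol.1.nonempty (hsub n) hWZ (mem_iInter.1 hp n)
  · exact mem_iInter.2 fun n => hp (Y n) ⟨m n, hY n, hsub n⟩
end

section
/- Let f : G → G be a graph map and x, y ∈ G. If ω_f(x) is a solenoid and ω_f(x) ∩ ω_f(y) ≠ ∅, then ω_f(x) ∪ ω_f(y) is also a solenoid; in particular there exists z ∈ G with ω_f(z) = ω_f(x) ∪ ω_f(y). -/
open Set Filter Topology

/-- A parametrised edge: a continuous map from the line, injective on `[0,1]`, which maps open
subintervals of `(0,1)` to open sets. -/
structure IsEdge {G : Type*} [TopologicalSpace G] (φ : ℝ → G) : Prop where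
  cont : Continuous φ
  inj : InjOn φ (Icc 0 1)
  isOpen_image : ∀ α β, 0 ≤ α → β ≤ 1 → IsOpen (φ '' Ioo α β)

theorem IsEdge.reverse {G : Type*} [TopologicalSpace G] {φ : ℝ → G} (h : IsEdge φ) :
    IsEdge (fun t => φ (1 - t)) := by
  refine ⟨h.cont.comp (by fun_prop), ?_, ?_⟩
  · intro s hs t ht hst
    have := h.inj (x₁ := 1 - s) ⟨by linarith [hs.2], by linarith [hs.1]⟩
      ⟨by linarith [ht.2], by linarith [ht.1]⟩ hst
    linarith
  · intro α β hα hβ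
    have : (fun t => φ (1 - t)) '' Ioo α β = φ '' Ioo (1 - β) (1 - α) := by
      rw [← Set.image_const_sub_Ioo, Set.image_image]
    rw [this]
    exact h.isOpen_image _ _ (by linarith) (by linarith)

theorem IsEdge.isClosed_image {G : Type*} [TopologicalSpace G] [T2Space G] {φ : ℝ → G}
    (h : IsEdge φ) (α β : ℝ) : IsClosed (φ '' Icc α β) :=
  (isCompact_Icc.image h.cont).isClosed

theorem IsEdge.closure_image {G : Type*} [TopologicalSpace G] [T2Space G] {φ : ℝ → G}
    (h : IsEdge φ) (α β : ℝ) : closure (φ '' Ioo α β) ⊆ φ '' Icc α β :=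
  closure_minimal (image_mono Ioo_subset_Icc_self) (h.isClosed_image α β)

theorem IsEdge.frontier_image {G : Type*} [TopologicalSpace G] [T2Space G] {φ : ℝ → G}
    (h : IsEdge φ) {α β : ℝ} (hα : 0 ≤ α) (hβ : β ≤ 1) :
    frontier (φ '' Ioo α β) ⊆ {φ α, φ β} := by
  intro p hp
  rw [(h.isOpen_image α β hα hβ).frontier_eq] at hp
  obtain ⟨t, ht, rfl⟩ := h.closure_image α β hp.1
  by_contra hne
  simp only [mem_insert_iff, mem_singleton_iff, not_or] at hne
  refine hp.2 ⟨t, ⟨lt_of_le_of_ne ht.1 ?_, lt_of_le_of_ne ht.2 ?_⟩, rfl⟩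
  · rintro rfl; exact hne.1 rfl
  · rintro rfl; exact hne.2 rfl

/-- A connected set meeting an open set but not its frontier lies inside it. -/
theorem IsPreconnected.subset_of_inter_frontier_eq_empty {G : Type*} [TopologicalSpace G]
    {C O : Set G} (hC : IsPreconnected C) (hO : IsOpen O) (hne : (C ∩ O).Nonempty)
    (hfr : C ∩ frontier O = ∅) : C ⊆ O := by
  refine hC.subset_of_closure_inter_subset hO hne ?_
  rintro p ⟨hp, hpC⟩
  by_contra hpO
  have : p ∈ C ∩ frontier O := ⟨hpC, by rw [hO.frontier_eq]; exact ⟨hp, hpO⟩⟩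
  rw [hfr] at this
  exact this

/-- A connected set avoiding the two end points of an open subarc, and meeting the subarc, lies
inside it. -/
theorem IsEdge.subset_of_notMem {G : Type*} [TopologicalSpace G] [T2Space G] {φ : ℝ → G}
    (h : IsEdge φ) {α β : ℝ} (hα : 0 ≤ α) (hβ : β ≤ 1) {C : Set G} (hC : IsPreconnected C)
    (h1 : φ α ∉ C) (h2 : φ β ∉ C) {t : ℝ} (ht : t ∈ Ioo α β) (htC : φ t ∈ C) :
    C ⊆ φ '' Ioo α β := by
  refine hC.subset_of_inter_frontier_eq_empty (h.isOpen_image α β hα hβ)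
    ⟨φ t, htC, mem_image_of_mem _ ht⟩ ?_
  rw [eq_empty_iff_forall_notMem]
  rintro p ⟨hpC, hp⟩
  rcases h.frontier_image hα hβ hp with rfl | rfl
  · exact h1 hpC
  · exact h2 hpC

/-- If two points of a connected set are separated on the edge by a point outside the set, then
between this point and the next one outside the set there are no points of the set. -/
theorem IsEdge.not_alternating {G : Type*} [TopologicalSpace G] [T2Space G] {φ : ℝ → G}
    (h : IsEdge φ) {C : Set G} (hC : IsPreconnected C) {a b c d : ℝ} (ha : 0 ≤ a)
    (hab : a < b) (hbc : b < c) (hcd : c < d) (hd : d ≤ 1)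
    (haC : φ a ∈ C) (hbC : φ b ∉ C) (hcC : φ c ∈ C) (hdC : φ d ∉ C) : False := by
  obtain ⟨t, ht, hta⟩ := h.subset_of_notMem (by linarith) hd hC hbC hdC ⟨hbc, hcd⟩ hcC haC
  have := h.inj (x₁ := t) ⟨by linarith [ht.1], by linarith [ht.2]⟩
    ⟨ha, by linarith⟩ hta
  linarith [ht.1]

theorem IsTopGraph.exists_edges {G : Type*} [TopologicalSpace G] [T2Space G]
    (hG : IsTopGraph G) : ∃ (n : ℕ) (φ : Fin n → ℝ → G), (∀ i, IsEdge (φ i)) ∧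
      ∀ p, ∃ i, ∃ t ∈ Icc (0 : ℝ) 1, φ i t = p := by
  obtain ⟨-, -, n, A, a, b, hA, hcov, h_int⟩ := hG
  choose ψ hψc hψi hψr hψa hψb using hA
  refine ⟨n, fun i t => ψ i (projIcc 0 1 zero_le_one t), fun i => ⟨?_, ?_, ?_⟩, ?_⟩
  · exact (hψc i).comp continuous_projIcc
  · intro s hs t ht hst
    have := hψi i hst
    rw [projIcc_of_mem _ hs, projIcc_of_mem _ ht] at this
    exact congrArg Subtype.val this
  · intro α β hα hβ
    have hcl : IsClosed ((⋃ j ∈ {j | j ≠ i}, A j) ∪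
        ψ i '' {t : Icc (0 : ℝ) 1 | (t : ℝ) ≤ α ∨ β ≤ t}) := by
      refine IsClosed.union ?_ ?_
      · refine (Set.toFinite _).isClosed_biUnion fun j _ => ?_
        rw [← hψr j]
        exact (isCompact_range (hψc j)).isClosed
      · refine (IsClosed.isCompact ?_ |>.image (hψc i)).isClosed
        exact (isClosed_le continuous_subtype_val continuous_const).union
          (isClosed_le continuous_const continuous_subtype_val)
    convert hcl.isOpen_compl using 1
    ext p
    simp only [mem_image, mem_compl_iff, mem_union, mem_iUnion, mem_ofPred_eq, not_or, not_exists,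
      not_and]
    constructor
    · rintro ⟨t, ht, rfl⟩
      have htI : t ∈ Icc (0 : ℝ) 1 := ⟨by linarith [ht.1], by linarith [ht.2]⟩
      rw [projIcc_of_mem _ htI]
      constructor
      · intro j hj hmem
        have hmi : ψ i ⟨t, htI⟩ ∈ A i ∩ A j := ⟨by rw [← hψr i]; exact mem_range_self _, hmem⟩
        rcases h_int i j (Ne.symm hj) with h0 | ⟨p, hp, hpi, -⟩
        · rw [h0] at hmi; exact hmi
        · rw [hp] at hmi
          rw [← mem_singleton_iff.1 hmi] at hpi
          rcases hpi with h0 | h1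
          · have := congrArg Subtype.val (hψi i (h0.trans (hψa i).symm))
            simp only at this
            linarith [ht.1]
          · have := congrArg Subtype.val (hψi i ((mem_singleton_iff.1 h1).trans (hψb i).symm))
            simp only at this
            linarith [ht.2]
      · intro s hs hst
        have := congrArg Subtype.val (hψi i hst)
        simp only at this
        rcases hs with hs | hs <;> [linarith [ht.1]; linarith [ht.2]]
    · rintro ⟨h1, h2⟩
      have hp : p ∈ ⋃ j, A j := by rw [hcov]; trivial
      obtain ⟨j, hj⟩ := mem_iUnion.1 hp
      have hji : j = i := by
        by_contra hne
        exact h1 j hne hj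
      subst hji
      rw [← hψr j] at hj
      obtain ⟨t, rfl⟩ := hj
      refine ⟨t, ⟨?_, ?_⟩, by simp⟩
      · by_contra hlt
        exact h2 t (Or.inl (not_lt.1 hlt)) rfl
      · by_contra hlt
        exact h2 t (Or.inr (not_lt.1 hlt)) rfl
  · intro p
    have hp : p ∈ ⋃ j, A j := by rw [hcov]; trivial
    obtain ⟨j, hj⟩ := mem_iUnion.1 hp
    rw [← hψr j] at hj
    obtain ⟨t, rfl⟩ := hj
    exact ⟨j, t, t.2, by simp⟩

/-- In a graph, a finite set cuts all connected sets which are not small. -/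
theorem IsTopGraph.exists_finite_cut {G : Type*} [MetricSpace G] (hG : IsTopGraph G)
    {ε : ℝ} (hε : 0 < ε) : ∃ P : Set G, P.Finite ∧
      ∀ C : Set G, IsPreconnected C → (C ∩ P).Nonempty ∨ ∀ p ∈ C, ∀ q ∈ C, dist p q ≤ ε := by
  obtain ⟨n, φ, hφ, hcov⟩ := hG.exists_edges
  have hm : ∀ i, ∃ m : ℕ, 0 < m ∧ ∀ s ∈ Icc (0 : ℝ) 1, ∀ t ∈ Icc (0 : ℝ) 1,
      |s - t| ≤ 1 / m → dist (φ i s) (φ i t) ≤ ε := by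
    intro i
    have := isCompact_Icc.uniformContinuousOn_of_continuous
      ((hφ i).cont.continuousOn (s := Icc (0 : ℝ) 1))
    rw [Metric.uniformContinuousOn_iff] at this
    obtain ⟨δ, hδ, h⟩ := this ε hε
    obtain ⟨m, hm⟩ := exists_nat_one_div_lt hδ
    refine ⟨m + 1, by omega, fun s hs t ht hst => (h s hs t ht ?_).le⟩
    rw [Real.dist_eq]
    push_cast at hst
    linarith
  choose m hm0 hm using hm
  refine ⟨⋃ i, (fun k : ℕ => φ i (k / m i)) '' {k | k ≤ m i}, ?_, ?_⟩
  · exact finite_iUnion fun i => (finite_le_nat (m i)).image _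
  · intro C hC
    by_contra! hcon
    obtain ⟨hP, p, hp, q, hq, hpq⟩ := hcon
    have hP' : ∀ i, ∀ k ≤ m i, φ i (k / m i) ∉ C := by
      intro i k hk hmem
      have : φ i (k / m i) ∈ C ∩ ⋃ i, (fun k : ℕ => φ i (k / m i)) '' {k | k ≤ m i} :=
        ⟨hmem, mem_iUnion.2 ⟨i, k, hk, rfl⟩⟩
      rw [hP] at this
      exact this
    obtain ⟨i, t, ht, rfl⟩ := hcov p
    have hmpos : (0 : ℝ) < m i := by exact_mod_cast hm0 i
    have hk1 := Nat.floor_le (mul_nonneg ht.1 hmpos.le)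
    have hk2 := Nat.lt_floor_add_one (t * m i)
    set k := ⌊t * m i⌋₊ with hk
    have hkm : k ≤ m i := by
      have : (k : ℝ) ≤ m i := by nlinarith [ht.2]
      exact_mod_cast this
    have hk1' : (k : ℝ) / m i < t := by
      refine lt_of_le_of_ne ((div_le_iff₀ hmpos).2 hk1) ?_
      intro heq
      exact hP' i k hkm (by rw [heq]; exact hp)
    have hk3 : k + 1 ≤ m i := by
      have : (k : ℝ) < m i := by
        have := (div_lt_iff₀ hmpos).1 hk1'
        nlinarith [ht.2]
      exact_mod_cast this
    have hk3' : ((k + 1 : ℕ) : ℝ) ≤ m i := by exact_mod_cast hk3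
    have hk2' : t < ((k + 1 : ℕ) : ℝ) / m i := by
      rw [lt_div_iff₀ hmpos]; push_cast; exact hk2
    have hb : ((k + 1 : ℕ) : ℝ) / m i ≤ 1 := (div_le_one hmpos).2 hk3'
    have h0 : (0 : ℝ) ≤ k / m i := by positivity
    have hsub := (hφ i).subset_of_notMem h0 hb hC (hP' i k hkm) (hP' i (k + 1) hk3)
      ⟨hk1', hk2'⟩ hp
    obtain ⟨s, hs, rfl⟩ := hsub hq
    refine absurd (hm i t ht s ⟨by linarith [hs.1], by linarith [hs.2]⟩ ?_) (not_le.2 hpq)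
    have e : ((k + 1 : ℕ) : ℝ) / m i = k / m i + 1 / m i := by push_cast; ring
    rw [abs_le]
    constructor <;> linarith [hs.1, hs.2]

/-- In a graph, connected sets have finite frontier. -/
theorem IsTopGraph.finite_frontier_s4 {G : Type*} [MetricSpace G] (hG : IsTopGraph G)
    {C : Set G} (hC : IsPreconnected C) : (frontier C).Finite := by
  obtain ⟨n, φ, hφ, hcov⟩ := hG.exists_edges
  have hedge : ∀ i, {t ∈ Ioo (0 : ℝ) 1 | φ i t ∈ frontier C}.Finite := by
    intro i
    by_contra hinf
    obtain ⟨F, hF, hcard⟩ := Set.Infinite.exists_subset_card_eq hinf 4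
    have key : ∀ t ∈ {t ∈ Ioo (0 : ℝ) 1 | φ i t ∈ frontier C}, ∀ l r, l < t → t < r →
        (∃ s ∈ Ioo l r ∩ Ioo 0 1, φ i s ∈ C) ∧ ∃ s ∈ Ioo l r ∩ Ioo 0 1, φ i s ∉ C := by
      intro t ht l r hl hr
      have hO := (hφ i).isOpen_image (max l 0) (min r 1) (le_max_right _ _) (min_le_right _ _)
      have htO : φ i t ∈ φ i '' Ioo (max l 0) (min r 1) :=
        mem_image_of_mem _ ⟨max_lt hl ht.1.1, lt_min hr ht.1.2⟩
      have hmem : ∀ s ∈ Ioo (max l 0) (min r 1), s ∈ Ioo l r ∩ Ioo 0 1 := fun s hs =>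
        ⟨⟨(le_max_left _ _).trans_lt hs.1, hs.2.trans_le (min_le_left _ _)⟩,
          (le_max_right _ _).trans_lt hs.1, hs.2.trans_le (min_le_right _ _)⟩
      constructor
      · have := mem_closure_iff.1 (frontier_subset_closure ht.2) _ hO htO
        obtain ⟨_, ⟨s, hs, rfl⟩, hsC⟩ := this
        exact ⟨s, hmem s hs, hsC⟩
      · have h2 := ht.2
        rw [frontier_eq_closure_inter_closure] at h2
        obtain ⟨_, ⟨s, hs, rfl⟩, hsC⟩ := mem_closure_iff.1 h2.2 _ hO htO
        exact ⟨s, hmem s hs, hsC⟩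
    have hmemF : ∀ k, F.orderEmbOfFin hcard k ∈ {t ∈ Ioo (0 : ℝ) 1 | φ i t ∈ frontier C} :=
      fun k => hF (F.orderEmbOfFin_mem hcard k)
    have hlt : ∀ {k l : Fin 4}, k < l → F.orderEmbOfFin hcard k < F.orderEmbOfFin hcard l :=
      fun h => (F.orderEmbOfFin hcard).strictMono h
    set g := F.orderEmbOfFin hcard with hg
    have h01 := hlt (show (0 : Fin 4) < 1 by decide)
    have h12 := hlt (show (1 : Fin 4) < 2 by decide)
    have h23 := hlt (show (2 : Fin 4) < 3 by decide)
    obtain ⟨⟨a, ha, haC⟩, -⟩ := key _ (hmemF 0) (g 0 - 1) ((g 0 + g 1) / 2) (by linarith)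
      (by linarith)
    obtain ⟨-, b, hb, hbC⟩ := key _ (hmemF 1) ((g 0 + g 1) / 2) ((g 1 + g 2) / 2) (by linarith)
      (by linarith)
    obtain ⟨⟨c, hc, hcC⟩, -⟩ := key _ (hmemF 2) ((g 1 + g 2) / 2) ((g 2 + g 3) / 2) (by linarith)
      (by linarith)
    obtain ⟨-, d, hd, hdC⟩ := key _ (hmemF 3) ((g 2 + g 3) / 2) (g 3 + 1) (by linarith)
      (by linarith)
    exact (hφ i).not_alternating hC ha.2.1.le (ha.1.2.trans hb.1.1) (hb.1.2.trans hc.1.1)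
      (hc.1.2.trans hd.1.1) hd.2.2.le haC hbC hcC hdC
  have hfin : (⋃ i, φ i '' ({t ∈ Ioo (0 : ℝ) 1 | φ i t ∈ frontier C} ∪ {0, 1})).Finite :=
    finite_iUnion fun i => ((hedge i).union (Set.toFinite _)).image _
  refine hfin.subset fun p hp => ?_
  obtain ⟨i, t, ht, rfl⟩ := hcov p
  refine mem_iUnion.2 ⟨i, mem_image_of_mem _ ?_⟩
  by_cases h0 : t = 0
  · right; left; exact h0
  by_cases h1 : t = 1
  · right; right; exact h1
  left
  exact ⟨⟨lt_of_le_of_ne ht.1 (Ne.symm h0), lt_of_le_of_ne ht.2 h1⟩, hp⟩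

/-- If a connected set is the union of two closed sets with at most one common point, then both
are connected. -/
theorem IsPreconnected.of_union_of_inter_subset_singleton {G : Type*} [TopologicalSpace G]
    {A B : Set G} {e : G} (hAB : IsPreconnected (A ∪ B)) (hA : IsClosed A) (hB : IsClosed B)
    (he : A ∩ B ⊆ {e}) : IsPreconnected A := by
  rw [isPreconnected_closed_iff] at hAB ⊢
  intro u v hu hv hcov hAu hAv
  have key : ∀ u v : Set G, IsClosed u → IsClosed v → A ⊆ u ∪ v → (A ∩ u).Nonempty →
      (A ∩ v).Nonempty → e ∉ A ∩ v → (A ∩ (u ∩ v)).Nonempty := by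
    intro u v hu hv hcov ⟨p, hp⟩ ⟨q, hq⟩ hev
    obtain ⟨r, -, hr1, hr2⟩ := hAB ((A ∩ u) ∪ B) (A ∩ v) ((hA.inter hu).union hB) (hA.inter hv)
      (by
        rintro r (hr | hr)
        · rcases hcov hr with h | h
          · exact Or.inl (Or.inl ⟨hr, h⟩)
          · exact Or.inr ⟨hr, h⟩
        · exact Or.inl (Or.inr hr))
      ⟨p, Or.inl hp.1, Or.inl hp⟩ ⟨q, Or.inl hq.1, hq⟩
    rcases hr1 with hr1 | hr1
    · exact ⟨r, hr2.1, hr1.2, hr2.2⟩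
    · have := he ⟨hr2.1, hr1⟩
      rw [mem_singleton_iff] at this
      exact absurd (this ▸ hr2) hev
  by_cases h1 : e ∈ A ∩ v
  · by_cases h2 : e ∈ A ∩ u
    · exact ⟨e, h1.1, h2.2, h1.2⟩
    · rw [inter_comm u v]
      exact key v u hv hu (by rwa [union_comm]) hAv hAu h2
  · exact key u v hu hv hcov hAu hAv h1

/-- Removing an open set whose frontier meets a continuum in at most one point. -/
theorem IsPreconnected.sdiff_and_inter_closure {G : Type*} [TopologicalSpace G]
    {J O : Set G} {e : G} (hJ : IsPreconnected J) (hJc : IsClosed J) (hO : IsOpen O)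
    (he : J ∩ frontier O ⊆ {e}) :
    IsPreconnected (J \ O) ∧ IsPreconnected (J ∩ closure O) := by
  have h1 : IsClosed (J \ O) := hJc.sdiff hO
  have h2 : IsClosed (J ∩ closure O) := hJc.inter isClosed_closure
  have h3 : J \ O ∪ J ∩ closure O = J := by
    ext p
    by_cases hp : p ∈ O
    · have := subset_closure hp
      simp [hp, this]
    · simp only [mem_union, Set.mem_sdiff, mem_inter_iff]
      tauto
  have h4 : J \ O ∩ (J ∩ closure O) ⊆ {e} := by
    rintro p ⟨⟨hpJ, hpO⟩, -, hpc⟩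
    refine he ⟨hpJ, ?_⟩
    rw [hO.frontier_eq]
    exact ⟨hpc, hpO⟩
  constructor
  · exact IsPreconnected.of_union_of_inter_subset_singleton (B := J ∩ closure O)
      (by rwa [h3]) h1 h2 h4
  · exact IsPreconnected.of_union_of_inter_subset_singleton (B := J \ O)
      (by rwa [union_comm, h3]) h2 h1 (by rwa [inter_comm])

/-- A decreasing sequence of closed sets with intersection inside an open set is eventually
inside that open set. -/
theorem exists_subset_of_iInter_subset {G : Type*} [TopologicalSpace G] [CompactSpace G]
    {C : ℕ → Set G} (hanti : Antitone C) (hcl : ∀ n, IsClosed (C n)) {O : Set G} (hO : IsOpen O)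
    (h : ⋂ n, C n ⊆ O) : ∃ n, C n ⊆ O := by
  by_contra! hcon
  have := IsCompact.nonempty_iInter_of_sequence_nonempty_isCompact_isClosed
    (fun n => C n \ O) (fun n => sdiff_subset_sdiff_left (hanti (Nat.le_succ n)))
    (fun n => by
      obtain ⟨p, hp, hpO⟩ := not_subset.1 (hcon n)
      exact ⟨p, hp, hpO⟩)
    ((hcl 0).sdiff hO).isCompact (fun n => (hcl n).sdiff hO)
  obtain ⟨p, hp⟩ := this
  rw [mem_iInter] at hp
  exact (hp 0).2 (h (mem_iInter.2 fun n => (hp n).1))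

theorem isPreconnected_iInter_of_antitone {G : Type*} [TopologicalSpace G] [CompactSpace G]
    [T2Space G] {C : ℕ → Set G} (hanti : Antitone C) (hcl : ∀ n, IsClosed (C n))
    (hpre : ∀ n, IsPreconnected (C n)) : IsPreconnected (⋂ n, C n) := by
  rw [isPreconnected_closed_iff]
  intro u v hu hv hcov ⟨p, hp, hpu⟩ ⟨q, hq, hqv⟩
  by_contra hne
  have hKc : IsClosed (⋂ n, C n) := isClosed_iInter hcl
  have hd : Disjoint ((⋂ n, C n) ∩ u) ((⋂ n, C n) ∩ v) := by
    rw [disjoint_left]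
    rintro r ⟨h1, h2⟩ ⟨-, h3⟩
    exact hne ⟨r, h1, h2, h3⟩
  obtain ⟨U, V, hU, hV, hUu, hVv, hUV⟩ := SeparatedNhds.of_isCompact_isCompact
    (hKc.inter hu).isCompact (hKc.inter hv).isCompact hd
  obtain ⟨n, hn⟩ := exists_subset_of_iInter_subset hanti hcl (hU.union hV) (fun r hr => by
    rcases hcov hr with h | h
    · exact Or.inl (hUu ⟨hr, h⟩)
    · exact Or.inr (hVv ⟨hr, h⟩))
  obtain ⟨r, -, hrU, hrV⟩ := hpre n U V hU hV hn ⟨p, mem_iInter.1 hp n, hUu ⟨hp, hpu⟩⟩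
    ⟨q, mem_iInter.1 hq n, hVv ⟨hq, hqv⟩⟩
  exact disjoint_left.1 hUV hrU hrV

section OmegaLimit

variable {G : Type*} [TopologicalSpace G] {f : G → G}

theorem mem_omegaSet_iff {u p : G} :
    p ∈ omegaSet f u ↔ ∀ O : Set G, IsOpen O → p ∈ O → ∀ n, ∃ t ≥ n, f^[t] u ∈ O := by
  simp only [omegaSet, mem_iInter, mem_closure_iff]
  constructor
  · intro h O hO hp n
    obtain ⟨_, h1, t, ht, rfl⟩ := h n O hO hp
    exact ⟨t, ht, h1⟩
  · intro h n O hO hp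
    obtain ⟨t, ht, h1⟩ := h O hO hp n
    exact ⟨_, h1, t, ht, rfl⟩

theorem isClosed_omegaSet (u : G) : IsClosed (omegaSet f u) :=
  isClosed_iInter fun _ => isClosed_closure

theorem omegaSet_subset_of_eventually {u : G} {A : Set G} (hA : IsClosed A)
    (h : ∀ᶠ t in atTop, f^[t] u ∈ A) : omegaSet f u ⊆ A := by
  intro p hp
  obtain ⟨N, hN⟩ := eventually_atTop.1 h
  by_contra hpA
  obtain ⟨t, ht, htA⟩ := mem_omegaSet_iff.1 hp Aᶜ hA.isOpen_compl hpA N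
  exact htA (hN t ht)

theorem omegaSet_nonempty_inter [CompactSpace G] {u : G} {A : Set G} (hA : IsClosed A)
    (h : ∀ n, ∃ t ≥ n, f^[t] u ∈ A) : (omegaSet f u ∩ A).Nonempty := by
  obtain ⟨p, hp⟩ := IsCompact.nonempty_iInter_of_sequence_nonempty_isCompact_isClosed
    (fun n => closure ((fun m => f^[m] u) '' Ici n) ∩ A)
    (fun n => inter_subset_inter_left _ (closure_mono (image_mono (Ici_subset_Ici.2 n.le_succ))))
    (fun n => by
      obtain ⟨t, ht, htA⟩ := h n
      exact ⟨_, subset_closure ⟨t, ht, rfl⟩, htA⟩)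
    (isClosed_closure.inter hA).isCompact (fun n => isClosed_closure.inter hA)
  rw [mem_iInter] at hp
  exact ⟨p, mem_iInter.2 fun n => (hp n).1, (hp 0).2⟩

theorem omegaSet_nonempty [CompactSpace G] (u : G) : (omegaSet f u).Nonempty := by
  obtain ⟨p, hp, -⟩ := omegaSet_nonempty_inter (f := f) (u := u) isClosed_univ
    (fun n => ⟨n, le_rfl, trivial⟩)
  exact ⟨p, hp⟩

theorem mapsTo_omegaSet (hf : Continuous f) (u : G) : MapsTo f (omegaSet f u) (omegaSet f u) := by
  intro p hp
  rw [mem_omegaSet_iff] at hp ⊢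
  intro O hO hpO n
  obtain ⟨t, ht, h⟩ := hp _ (hO.preimage hf) hpO n
  refine ⟨t + 1, by omega, ?_⟩
  rw [Function.iterate_succ_apply']
  exact h

theorem omegaSet_iterate (u : G) (k : ℕ) : omegaSet f (f^[k] u) = omegaSet f u := by
  ext p
  simp only [mem_omegaSet_iff]
  constructor
  · intro h O hO hp n
    obtain ⟨t, ht, h1⟩ := h O hO hp n
    exact ⟨t + k, by omega, by rwa [Function.iterate_add_apply]⟩
  · intro h O hO hp n
    obtain ⟨t, ht, h1⟩ := h O hO hp (n + k)
    refine ⟨t - k, by omega, ?_⟩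
    rwa [← Function.iterate_add_apply, Nat.sub_add_cancel (by omega)]

theorem omegaSet_subset_image [CompactSpace G] [T2Space G] (hf : Continuous f) (u : G) :
    omegaSet f u ⊆ f '' omegaSet f u := by
  intro p hp
  by_contra hne
  have hcl : IsClosed (f '' omegaSet f u) := ((isClosed_omegaSet u).isCompact.image hf).isClosed
  obtain ⟨U, V, hU, hV, hUp, hVv, hUV⟩ := SeparatedNhds.of_isCompact_isCompact
    (isCompact_singleton (x := p)) hcl.isCompact (disjoint_singleton_left.2 hne)
  obtain ⟨q, hq, hqV⟩ := omegaSet_nonempty_inter (f := f) (u := u) (A := f ⁻¹' Vᶜ)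
    (hV.isClosed_compl.preimage hf) (fun n => by
      obtain ⟨t, ht, h⟩ := mem_omegaSet_iff.1 hp U hU (hUp rfl) (n + 1)
      refine ⟨t - 1, by omega, ?_⟩
      rw [mem_preimage, ← Function.iterate_succ_apply' f, Nat.succ_eq_add_one,
        Nat.sub_add_cancel (by omega)]
      exact disjoint_left.1 hUV h)
  exact hqV (hVv ⟨q, hq, rfl⟩)

end OmegaLimit

/-- The components of a proper closed subset of a continuum reach the frontier. -/
theorem connectedComponentIn_inter_frontier_nonempty {G : Type*} [TopologicalSpace G]
    [CompactSpace G] [T2Space G] [PreconnectedSpace G] {Z : Set G} (hZ : IsClosed Z)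
    (hne : Z ≠ univ) {q : G} (hq : q ∈ Z) : (connectedComponentIn Z q ∩ frontier Z).Nonempty := by
  by_contra hcon
  rw [not_nonempty_iff_eq_empty] at hcon
  have : CompactSpace Z := isCompact_iff_compactSpace.1 hZ.isCompact
  have hsub : connectedComponent (⟨q, hq⟩ : Z) ⊆ (Subtype.val ⁻¹' frontier Z)ᶜ := by
    intro r hr hrf
    have : (r : G) ∈ connectedComponentIn Z q ∩ frontier Z := by
      refine ⟨?_, hrf⟩
      rw [connectedComponentIn_eq_image hq]
      exact mem_image_of_mem _ hr
    rw [hcon] at this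
    exact this
  rw [connectedComponent_eq_iInter_isClopen] at hsub
  have hopen : IsOpen ((Subtype.val ⁻¹' frontier Z)ᶜ : Set Z) :=
    (isClosed_frontier.preimage continuous_subtype_val).isOpen_compl
  have : Nonempty {s : Set Z // IsClopen s ∧ (⟨q, hq⟩ : Z) ∈ s} :=
    ⟨⟨univ, isClopen_univ, trivial⟩⟩
  obtain ⟨K, hK⟩ := exists_subset_nhds_of_isCompact (X := Z)
    (ι := {s : Set Z // IsClopen s ∧ (⟨q, hq⟩ : Z) ∈ s}) (V := fun s => s.1)
    (by
      rintro ⟨a, ha, ha'⟩ ⟨b, hb, hb'⟩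
      exact ⟨⟨a ∩ b, ha.inter hb, ha', hb'⟩, inter_subset_left, inter_subset_right⟩)
    (fun s => s.2.1.isClosed.isCompact) (fun r hr => hopen.mem_nhds (hsub hr))
  obtain ⟨K, hKc, hKq⟩ := K
  simp only at hK
  have h1 : IsClosed (Subtype.val '' K) :=
    hZ.isClosedEmbedding_subtypeVal.isClosedMap _ hKc.isClosed
  obtain ⟨O, hO, hOK⟩ := isOpen_induced_iff.1 hKc.isOpen
  have h2 : Subtype.val '' K = O ∩ interior Z := by
    ext r
    constructor
    · rintro ⟨s, hs, rfl⟩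
      refine ⟨by rw [← hOK] at hs; exact hs, ?_⟩
      have := hK hs
      by_contra h_int
      exact this ⟨subset_closure s.2, h_int⟩
    · rintro ⟨hr, hrZ⟩
      exact ⟨⟨r, interior_subset hrZ⟩, by rw [← hOK]; exact hr, rfl⟩
  have h3 : IsClopen (Subtype.val '' K) := ⟨h1, by rw [h2]; exact hO.inter isOpen_interior⟩
  have h4 := h3.eq_univ ⟨q, ⟨q, hq⟩, hKq, rfl⟩
  apply hne
  rw [eq_univ_iff_forall]
  intro r
  have : r ∈ Subtype.val '' K := by rw [h4]; trivial
  obtain ⟨s, -, rfl⟩ := this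
  exact s.2

/-- A closed subset of a continuum with finite frontier has finitely many components. -/
theorem finite_connectedComponentIn_of_finite_frontier {G : Type*} [TopologicalSpace G]
    [CompactSpace G] [T2Space G] [PreconnectedSpace G] {Z : Set G} (hZ : IsClosed Z)
    (hfr : (frontier Z).Finite) : (connectedComponentIn Z '' Z).Finite := by
  by_cases hne : Z = univ
  · subst hne
    have : connectedComponentIn (univ : Set G) '' univ ⊆ {univ} := by
      rintro _ ⟨q, -, rfl⟩
      rw [connectedComponentIn_univ, PreconnectedSpace.connectedComponent_eq_univ]
      rfl
    exact (finite_singleton _).subset this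
  · refine (hfr.image (connectedComponentIn Z)).subset ?_
    rintro _ ⟨q, hq, rfl⟩
    obtain ⟨r, hr1, hr2⟩ := connectedComponentIn_inter_frontier_nonempty hZ hne hq
    exact ⟨r, hr2, (connectedComponentIn_eq hr1).symm⟩

theorem isClosed_connectedComponentIn {G : Type*} [TopologicalSpace G] {Z : Set G}
    (hZ : IsClosed Z) (q : G) : IsClosed (connectedComponentIn Z q) := by
  by_cases hq : q ∈ Z
  · refine isClosed_of_closure_subset ?_
    refine isPreconnected_connectedComponentIn.closure.subset_connectedComponentIn
      (subset_closure (mem_connectedComponentIn hq)) ?_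
    exact closure_minimal (connectedComponentIn_subset Z q) hZ
  · rw [connectedComponentIn_eq_empty hq]
    exact isClosed_empty

/-- A finite set meets only finitely many members of a disjoint sequence. -/
theorem exists_forall_ge_inter_eq_empty {G : Type*} {A : ℕ → Set G} {P : Set G} (hP : P.Finite)
    (hA : ∀ i j, i < j → Disjoint (A i) (A j)) : ∃ N, ∀ j ≥ N, A j ∩ P = ∅ := by
  by_contra! hcon
  have hinf : {j | (A j ∩ P).Nonempty}.Infinite := by
    rw [Set.infinite_iff_exists_gt]
    intro a
    obtain ⟨j, hj, hne⟩ := hcon (a + 1)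
    exact ⟨j, hne, by omega⟩
  have : Nonempty G := ⟨(hcon 0).choose_spec.2.some⟩
  choose! g hg using fun j (hj : j ∈ {j | (A j ∩ P).Nonempty}) => hj
  obtain ⟨i, hi, j, hj, hij, he⟩ := hinf.exists_ne_map_eq_of_mapsTo (fun j hj => (hg j hj).2) hP
  rcases lt_or_gt_of_ne hij with h | h
  · exact disjoint_left.1 (hA i j h) (hg i hi).1 (he ▸ (hg j hj).1)
  · exact disjoint_left.1 (hA j i h) (hg j hj).1 (he ▸ (hg i hi).1)

theorem connectedComponentIn_iterate_subset {G : Type*} [TopologicalSpace G] {f : G → G}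
    (hf : Continuous f) {A : Set G} (hA : MapsTo f A A) {I : Set G} (hI : IsPreconnected I)
    (hIA : I ⊆ A) (t : ℕ) {p : G} (hp : p ∈ f^[t] '' I) :
    f^[t] '' I ⊆ connectedComponentIn A p := by
  refine (hI.image _ (hf.iterate t).continuousOn).subset_connectedComponentIn hp ?_
  rintro _ ⟨q, hq, rfl⟩
  exact hA.iterate t (hIA hq)

/-- A decreasing sequence of closed invariant sets whose components are permuted transitively with
longer and longer return times. -/
structure IsTower {G : Type*} [TopologicalSpace G] (f : G → G) (Y : ℕ → Set G) : Prop where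
  closed : ∀ n, IsClosed (Y n)
  anti : Antitone Y
  mapsTo : ∀ n, MapsTo f (Y n) (Y n)
  visit : ∀ n, ∀ q ∈ Y n, ∀ q' ∈ Y n, ∀ T, ∃ t ≥ T, f^[t] q ∈ connectedComponentIn (Y n) q'
  leave : ∀ n, ∀ q ∈ Y n, ∀ t, 0 < t → t ≤ n → f^[t] q ∉ connectedComponentIn (Y n) q

/-- The intersection of a tower. -/
def towerCore {G : Type*} (Y : ℕ → Set G) : Set G := ⋂ n, Y n

/-- The component of the intersection of a tower containing a given point. -/
def towerFiber {G : Type*} [TopologicalSpace G] (Y : ℕ → Set G) (q : G) : Set G :=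
  connectedComponentIn (towerCore Y) q

/-- The points accumulated by fibers: this is the unique minimal set of the tower. -/
def towerMinimal {G : Type*} [TopologicalSpace G] (Y : ℕ → Set G) : Set G :=
  {σ | ∀ O, IsOpen O → σ ∈ O → ∃ q ∈ towerCore Y, towerFiber Y q ⊆ O}

/-- A point whose orbit eventually enters all levels of the tower. -/
def IsAttracted {G : Type*} (f : G → G) (Y : ℕ → Set G) (u : G) : Prop :=
  ∀ n, ∀ᶠ t in atTop, f^[t] u ∈ Y n

theorem towerFiber_subset_component {G : Type*} [TopologicalSpace G] (Y : ℕ → Set G) (q : G)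
    (n : ℕ) : towerFiber Y q ⊆ connectedComponentIn (Y n) q :=
  connectedComponentIn_mono q (iInter_subset Y n)

namespace IsTower

section Topological

variable {G : Type*} [TopologicalSpace G] {f : G → G} {Y : ℕ → Set G}

theorem mapsTo_core (hY : IsTower f Y) : MapsTo f (towerCore Y) (towerCore Y) := by
  intro q hq
  exact mem_iInter.2 fun n => hY.mapsTo n (mem_iInter.1 hq n)

theorem isAttracted_of_mem_core (hY : IsTower f Y) {q : G} (hq : q ∈ towerCore Y) :
    IsAttracted f Y q := fun n =>
  Eventually.of_forall fun t => (hY.mapsTo n).iterate t (mem_iInter.1 hq n)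

theorem omegaSet_subset_core (hY : IsTower f Y) {u : G} (hu : IsAttracted f Y u) :
    omegaSet f u ⊆ towerCore Y :=
  subset_iInter fun n => omegaSet_subset_of_eventually (hY.closed n) (hu n)

theorem iterate_notMem_fiber (hY : IsTower f Y) {q : G} (hq : q ∈ towerCore Y) {t : ℕ}
    (ht : 0 < t) : f^[t] q ∉ towerFiber Y q := fun h =>
  hY.leave t q (mem_iInter.1 hq t) t ht le_rfl (towerFiber_subset_component Y q t h)

theorem disjoint_fiber (hY : IsTower f Y) {q : G} (hq : q ∈ towerCore Y) {t : ℕ}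
    (ht : 0 < t) : Disjoint (towerFiber Y q) (towerFiber Y (f^[t] q)) := by
  rw [disjoint_left]
  intro p hp1 hp2
  apply hY.iterate_notMem_fiber hq ht
  have h1 := connectedComponentIn_eq hp1
  have h2 := connectedComponentIn_eq hp2
  rw [towerFiber, h1, ← h2]
  exact mem_connectedComponentIn (hY.mapsTo_core.iterate t hq)

theorem disjoint_fiber_iterate (hY : IsTower f Y) {q : G} (hq : q ∈ towerCore Y) {i j : ℕ}
    (hij : i < j) : Disjoint (towerFiber Y (f^[i] q)) (towerFiber Y (f^[j] q)) := by
  have := hY.disjoint_fiber (hY.mapsTo_core.iterate i hq) (Nat.sub_pos_of_lt hij)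
  rwa [← Function.iterate_add_apply, Nat.sub_add_cancel hij.le] at this

theorem fiber_eq (hY : IsTower f Y) [CompactSpace G] [T2Space G] {q : G}
    (hq : q ∈ towerCore Y) : towerFiber Y q = ⋂ n, connectedComponentIn (Y n) q := by
  refine Subset.antisymm (subset_iInter fun n => towerFiber_subset_component Y q n) ?_
  refine IsPreconnected.subset_connectedComponentIn ?_
    (mem_iInter.2 fun n => mem_connectedComponentIn (mem_iInter.1 hq n))
    (iInter_mono fun n => connectedComponentIn_subset _ _)
  exact isPreconnected_iInter_of_antitone
    (fun m n hmn => connectedComponentIn_mono q (hY.anti hmn))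
    (fun n => isClosed_connectedComponentIn (hY.closed n) q)
    (fun n => isPreconnected_connectedComponentIn)

theorem exists_component_subset (hY : IsTower f Y) [CompactSpace G] [T2Space G] {q : G}
    (hq : q ∈ towerCore Y) {O : Set G} (hO : IsOpen O) (h : towerFiber Y q ⊆ O) :
    ∃ n₀, ∀ n ≥ n₀, connectedComponentIn (Y n) q ⊆ O := by
  rw [hY.fiber_eq hq] at h
  obtain ⟨n₀, hn₀⟩ := exists_subset_of_iInter_subset
    (fun m n hmn => connectedComponentIn_mono q (hY.anti hmn))
    (fun n => isClosed_connectedComponentIn (hY.closed n) q) hO h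
  exact ⟨n₀, fun n hn => (connectedComponentIn_mono q (hY.anti hn)).trans hn₀⟩

theorem minimal_subset_omegaSet (hY : IsTower f Y) [CompactSpace G] [T2Space G] {u : G}
    (hu : IsAttracted f Y u) : towerMinimal Y ⊆ omegaSet f u := by
  intro σ hσ
  rw [mem_omegaSet_iff]
  intro O hO hσO N
  obtain ⟨q, hq, hqO⟩ := hσ O hO hσO
  obtain ⟨n, hn⟩ := hY.exists_component_subset hq hO hqO
  obtain ⟨t₀, ht₀⟩ := (hu n).exists_forall_of_atTop
  obtain ⟨t, -, ht⟩ := hY.visit n _ (ht₀ (max N t₀) (le_max_right _ _)) q (mem_iInter.1 hq n) 0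
  refine ⟨t + max N t₀, by have := le_max_left N t₀; omega, ?_⟩
  rw [Function.iterate_add_apply]
  exact hn n le_rfl ht

/-- The limit set of an attracted point does not meet the interior of a fiber. -/
theorem omegaSet_inter_interior_fiber (hY : IsTower f Y) {u : G} {q p : G}
    (hp : p ∈ omegaSet f u) : p ∉ interior (towerFiber Y q) := by
  intro hpq
  rw [mem_omegaSet_iff] at hp
  obtain ⟨t, -, ht⟩ := hp _ isOpen_interior hpq 0
  obtain ⟨s, hs, hs'⟩ := hp _ isOpen_interior hpq (t + 1)
  have h1 := interior_subset ht
  have h2 := interior_subset hs'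
  have hc : f^[t] u ∈ towerCore Y := connectedComponentIn_subset _ _ h1
  apply hY.iterate_notMem_fiber hc (Nat.sub_pos_of_lt hs)
  rw [← Function.iterate_add_apply, Nat.sub_add_cancel (by omega), towerFiber,
    ← connectedComponentIn_eq h1]
  exact h2

/-- Going backwards inside a limit set one reaches fibers avoiding a given finite set. -/
theorem exists_preimage_fiber_inter_eq_empty (hY : IsTower f Y) (hf : Continuous f)
    [CompactSpace G] [T2Space G] {P : Set G} (hP : P.Finite) {u : G} (hu : IsAttracted f Y u)
    {r : G} (hr : r ∈ omegaSet f u) :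
    ∃ j, ∃ r' ∈ omegaSet f u, f^[j] r' = r ∧ towerFiber Y r' ∩ P = ∅ := by
  have hpre : ∀ p : omegaSet f u, ∃ p' : omegaSet f u, f p' = p := by
    rintro ⟨p, hp⟩
    obtain ⟨p', hp', h⟩ := omegaSet_subset_image hf u hp
    exact ⟨⟨p', hp'⟩, h⟩
  choose g hg using hpre
  have hgi : ∀ j (p : omegaSet f u), f^[j] (g^[j] p) = p := by
    intro j
    induction j with
    | zero => intro p; rfl
    | succ j ih =>
      intro p
      rw [Function.iterate_succ_apply, Function.iterate_succ_apply', hg, ih]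
  have hd : ∀ i j, i < j → Disjoint (towerFiber Y (g^[i] ⟨r, hr⟩ : omegaSet f u))
      (towerFiber Y (g^[j] ⟨r, hr⟩ : omegaSet f u)) := by
    intro i j hij
    have h1 := hY.disjoint_fiber (t := j - i) (hY.omegaSet_subset_core hu (g^[j] ⟨r, hr⟩).2)
      (by omega)
    have h2 := hgi (j - i) (g^[i] ⟨r, hr⟩)
    rw [← Function.iterate_add_apply, Nat.sub_add_cancel hij.le] at h2
    rw [h2] at h1
    exact h1.symm
  obtain ⟨N, hN⟩ := exists_forall_ge_inter_eq_empty hP hd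
  exact ⟨N, _, (g^[N] ⟨r, hr⟩).2, hgi N ⟨r, hr⟩, hN N le_rfl⟩

end Topological

section Graph

variable {G : Type*} [MetricSpace G] {f : G → G} {Y : ℕ → Set G}

theorem omegaSet_core_subset_minimal (hY : IsTower f Y) (hG : IsTopGraph G) {q : G}
    (hq : q ∈ towerCore Y) : omegaSet f q ⊆ towerMinimal Y := by
  intro σ hσ O hO hσO
  obtain ⟨ε, hε, hball⟩ := Metric.isOpen_iff.1 hO σ hσO
  obtain ⟨P, hP, hcut⟩ := hG.exists_finite_cut (half_pos hε)
  obtain ⟨N, hN⟩ := exists_forall_ge_inter_eq_empty hP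
    (fun i j hij => hY.disjoint_fiber_iterate hq hij)
  obtain ⟨t, ht, hσt⟩ := mem_omegaSet_iff.1 hσ _ Metric.isOpen_ball
    (Metric.mem_ball_self (half_pos hε)) N
  have hqt := hY.mapsTo_core.iterate t hq
  refine ⟨f^[t] q, hqt, fun p hp => hball ?_⟩
  rcases hcut _ (isPreconnected_connectedComponentIn (F := towerCore Y) (x := f^[t] q)) with h | h
  · exact absurd (hN t ht) h.ne_empty
  · have := h p hp _ (mem_connectedComponentIn hqt)
    rw [Metric.mem_ball] at hσt ⊢
    linarith [dist_triangle p (f^[t] q) σ]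

theorem omegaSet_eq_minimal (hY : IsTower f Y) (hG : IsTopGraph G) {q : G}
    (hq : q ∈ towerCore Y) : omegaSet f q = towerMinimal Y := by
  have := hG.1
  exact (hY.omegaSet_core_subset_minimal hG hq).antisymm
    (hY.minimal_subset_omegaSet (hY.isAttracted_of_mem_core hq))

theorem omegaSet_eq_minimal_of_iterate (hY : IsTower f Y) (hG : IsTopGraph G) {u : G} {t : ℕ}
    (h : f^[t] u ∈ towerCore Y) : omegaSet f u = towerMinimal Y := by
  rw [← omegaSet_iterate u t, hY.omegaSet_eq_minimal hG h]

theorem minimal_subset_core (hY : IsTower f Y) (hG : IsTopGraph G) {q : G}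
    (hq : q ∈ towerCore Y) : towerMinimal Y ⊆ towerCore Y := by
  have := hG.1
  exact (hY.minimal_subset_omegaSet (hY.isAttracted_of_mem_core hq)).trans
    (hY.omegaSet_subset_core (hY.isAttracted_of_mem_core hq))

theorem mapsTo_minimal (hY : IsTower f Y) (hG : IsTopGraph G) (hf : Continuous f) {q : G}
    (hq : q ∈ towerCore Y) : MapsTo f (towerMinimal Y) (towerMinimal Y) := by
  rw [← hY.omegaSet_eq_minimal hG hq]
  exact mapsTo_omegaSet hf q

theorem isClosed_minimal (hY : IsTower f Y) (hG : IsTopGraph G) {q : G}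
    (hq : q ∈ towerCore Y) : IsClosed (towerMinimal Y) := by
  rw [← hY.omegaSet_eq_minimal hG hq]
  exact isClosed_omegaSet q

theorem exists_iterate_minimal_mem (hY : IsTower f Y) (hG : IsTopGraph G) (hf : Continuous f)
    {s : G} (hs : s ∈ towerMinimal Y) (hsc : s ∈ towerCore Y) {O : Set G} (hO : IsOpen O)
    (hsO : s ∈ O) : ∃ s' ∈ towerMinimal Y, s' ∈ O ∧ s' ∉ towerFiber Y s := by
  have h := hs
  rw [← hY.omegaSet_eq_minimal hG hsc] at h
  obtain ⟨t, ht, htO⟩ := mem_omegaSet_iff.1 h O hO hsO 1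
  exact ⟨f^[t] s, (hY.mapsTo_minimal hG hf hsc).iterate t hs, htO,
    hY.iterate_notMem_fiber hsc (by omega)⟩

theorem minimal_inter_fiber_nonempty (hY : IsTower f Y) (hG : IsTopGraph G) (hf : Continuous f)
    {q : G} (hq : q ∈ towerCore Y) : (towerMinimal Y ∩ towerFiber Y q).Nonempty := by
  have := hG.1
  have hcl := hY.isClosed_minimal hG hq
  obtain ⟨p, hp⟩ := IsCompact.nonempty_iInter_of_sequence_nonempty_isCompact_isClosed
    (fun n => towerMinimal Y ∩ connectedComponentIn (Y n) q)
    (fun n => inter_subset_inter_right _ (connectedComponentIn_mono q (hY.anti n.le_succ)))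
    (fun n => by
      obtain ⟨s, hs⟩ : (towerMinimal Y).Nonempty := by
        rw [← hY.omegaSet_eq_minimal hG hq]
        exact omegaSet_nonempty q
      obtain ⟨t, -, ht⟩ := hY.visit n s (mem_iInter.1 (hY.minimal_subset_core hG hq hs) n) q
        (mem_iInter.1 hq n) 0
      exact ⟨_, (hY.mapsTo_minimal hG hf hq).iterate t hs, ht⟩)
    (hcl.inter (isClosed_connectedComponentIn (hY.closed 0) q)).isCompact
    (fun n => hcl.inter (isClosed_connectedComponentIn (hY.closed n) q))
  rw [mem_iInter] at hp
  refine ⟨p, (hp 0).1, ?_⟩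
  rw [hY.fiber_eq hq]
  exact mem_iInter.2 fun n => (hp n).2

end Graph

end IsTower

/-- A connected set containing two points of an edge, but not its origin, contains the subarc
between them. -/
theorem IsEdge.image_Icc_subset {G : Type*} [TopologicalSpace G] [T2Space G] {φ : ℝ → G}
    (h : IsEdge φ) {C : Set G} (hC : IsPreconnected C) (h0 : φ 0 ∉ C) {a b : ℝ} (ha : 0 ≤ a)
    (hb : b ≤ 1) (haC : φ a ∈ C) (hbC : φ b ∈ C) : φ '' Icc a b ⊆ C := by
  rintro _ ⟨t, ht, rfl⟩
  by_contra htC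
  have hat : a < t := lt_of_le_of_ne ht.1 (by rintro rfl; exact htC haC)
  have ha0 : 0 < a := lt_of_le_of_ne ha (by rintro rfl; exact h0 haC)
  obtain ⟨u, hu, hub⟩ := h.subset_of_notMem le_rfl (ht.2.trans hb) hC h0 htC ⟨ha0, hat⟩ haC hbC
  have := h.inj (x₁ := u) ⟨hu.1.le, by linarith [hu.2, ht.2]⟩ ⟨by linarith [ht.2], hb⟩ hub
  linarith [hu.2, ht.2]

/-- An arc attached to a fiber at a point `φ ρ` of its frontier, in the direction away from a
point `φ ς` of the fiber which is accumulated by the minimal set from the other side. -/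
structure IsFiberArc {G : Type*} [TopologicalSpace G] (Y : ℕ → Set G) (φ : ℝ → G) (ς ρ : ℝ) :
    Prop where
  edge : IsEdge φ
  pos : 0 < ς
  lt : ς < ρ
  lt_one : ρ < 1
  subset_core : φ '' Icc ς ρ ⊆ towerCore Y
  exists_minimal : ∀ l < ς, ∃ ξ ∈ Ioo l ς, φ ξ ∈ towerMinimal Y
  exists_notMem : ∀ h, ρ < h → ∃ t ∈ Ioo ρ h, t < 1 ∧ φ t ∉ towerCore Y

/-- A set of points attracted by the tower without ever falling in its core, and whose limit sets
are not minimal. -/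
structure IsConfiguration {G : Type*} [MetricSpace G] (f : G → G) (Y : ℕ → Set G) (E : Set G) :
    Prop where
  graph : IsTopGraph G
  cont : Continuous f
  tower : IsTower f Y
  finite : E.Finite
  nonempty : E.Nonempty
  attracted : ∀ a ∈ E, IsAttracted f Y a
  notMem_core : ∀ a ∈ E, ∀ t, f^[t] a ∉ towerCore Y
  not_subset : ∀ a ∈ E, ¬ omegaSet f a ⊆ towerMinimal Y

/-- A set which can be cut off from continua in `Y n` keeping a part of the minimal set in the
interior. -/
def IsCuttable {G : Type*} [TopologicalSpace G] (Y : ℕ → Set G) (n : ℕ) (O : Set G) : Prop :=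
  ∀ I : Set G, IsClosed I → IsPreconnected I → I ⊆ Y n → (∃ w ∈ I, w ∉ O ∧ w ∉ towerCore Y) →
    (I ∩ O).Nonempty → IsPreconnected (I \ O) ∧ (towerCore Y ∩ (I \ O)).Nonempty ∧
      (towerMinimal Y ∩ interior (I \ O)).Nonempty

/-- An open set which can be cut off from continua and is eventually avoided by the orbits of the
points of `E`. -/
structure IsRegion {G : Type*} [TopologicalSpace G] (f : G → G) (Y : ℕ → Set G) (E O : Set G) :
    Prop where
  isOpen : IsOpen O
  avoid : ∀ a ∈ E, ∀ᶠ t in atTop, f^[t] a ∉ O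
  cut : ∃ N, ∀ n ≥ N, IsCuttable Y n O

theorem exists_forall_notMem_of_notMem_core {G : Type*} {Y : ℕ → Set G} (hY : Antitone Y) {p : G}
    (hp : p ∉ towerCore Y) : ∃ N, ∀ n ≥ N, p ∉ Y n := by
  rw [towerCore, mem_iInter, not_forall] at hp
  obtain ⟨N, hN⟩ := hp
  exact ⟨N, fun n hn h => hN (hY hn h)⟩

namespace IsConfiguration

variable {G : Type*} [MetricSpace G] {f : G → G} {Y : ℕ → Set G} {E : Set G}

theorem fiberArc_of_lt (H : IsConfiguration f Y E) {φ : ℝ → G} (hφ : IsEdge φ) {ς ρ : ℝ}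
    (hς : 0 ≤ ς) (hςρ : ς < ρ) (hρ : ρ ≤ 1) (hs : φ ς ∈ towerMinimal Y)
    (hsr : φ ς ∈ towerFiber Y (φ ρ)) (hr : φ ρ ∈ towerCore Y)
    (h0 : φ 0 ∉ towerFiber Y (φ ρ)) (h1 : φ 1 ∉ towerFiber Y (φ ρ))
    (h_int : φ ρ ∉ interior (towerFiber Y (φ ρ))) : IsFiberArc Y φ ς ρ := by
  have hrr : φ ρ ∈ towerFiber Y (φ ρ) := mem_connectedComponentIn hr
  have hconn : IsPreconnected (towerFiber Y (φ ρ)) := isPreconnected_connectedComponentIn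
  have hς0 : 0 < ς := lt_of_le_of_ne hς (by rintro rfl; exact h0 hsr)
  have hρ1 : ρ < 1 := lt_of_le_of_ne hρ (by rintro rfl; exact h1 hrr)
  have hIcc := hφ.image_Icc_subset hconn h0 hς hρ hsr hrr
  have hout : ∀ t, ρ < t → t < 1 → φ t ∉ towerFiber Y (φ ρ) := by
    intro t ht ht1 htf
    apply h_int
    rw [mem_interior]
    refine ⟨φ '' Ioo ς t, ?_, hφ.isOpen_image _ _ hς ht1.le, mem_image_of_mem _ ⟨hςρ, ht⟩⟩
    exact (image_mono Ioo_subset_Icc_self).trans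
      (hφ.image_Icc_subset hconn h0 hς ht1.le hsr htf)
  refine ⟨hφ, hς0, hςρ, hρ1, hIcc.trans (connectedComponentIn_subset _ _), ?_, ?_⟩
  · intro l hl
    have hsc : φ ς ∈ towerCore Y := connectedComponentIn_subset _ _ hsr
    obtain ⟨s', hs', ⟨ξ, hξ, rfl⟩, hs'f⟩ := H.tower.exists_iterate_minimal_mem H.graph H.cont hs hsc
      (hφ.isOpen_image (max l 0) ρ (le_max_right _ _) hρ)
      (mem_image_of_mem _ ⟨max_lt hl hς0, hςρ⟩)
    refine ⟨ξ, ⟨(le_max_left _ _).trans_lt hξ.1, ?_⟩, hs'⟩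
    by_contra hlt
    apply hs'f
    have : towerFiber Y (φ ς) = towerFiber Y (φ ρ) := (connectedComponentIn_eq hsr).symm
    rw [this]
    exact hIcc (mem_image_of_mem _ ⟨not_lt.1 hlt, hξ.2.le⟩)
  · intro h hh
    by_contra! hcon
    have hm : ρ < min h 1 := lt_min hh hρ1
    obtain ⟨t, ht1, ht2⟩ := exists_between hm
    have hth := ht2.trans_le (min_le_left _ _)
    have ht3 := ht2.trans_le (min_le_right _ _)
    refine hout t ht1 ht3 ?_
    have hpre : IsPreconnected (φ '' Icc ρ t) := isPreconnected_Icc.image _ hφ.cont.continuousOn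
    refine hpre.subset_connectedComponentIn (mem_image_of_mem _ ⟨le_rfl, ht1.le⟩) ?_
      (mem_image_of_mem _ ⟨ht1.le, le_rfl⟩)
    rintro _ ⟨u, hu, rfl⟩
    rcases eq_or_lt_of_le hu.1 with rfl | hu1
    · exact hr
    · exact hcon u ⟨hu1, hu.2.trans_lt hth⟩ (hu.2.trans_lt ht3)

theorem exists_fiberArc (H : IsConfiguration f Y E) {n : ℕ} {φ : Fin n → ℝ → G}
    (hφ : ∀ i, IsEdge (φ i)) (hcov : ∀ p, ∃ i, ∃ t ∈ Icc (0 : ℝ) 1, φ i t = p) {r : G}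
    (hr : r ∈ towerCore Y) (hv : towerFiber Y r ∩ ⋃ i, {φ i 0, φ i 1} = ∅)
    (h_int : r ∉ interior (towerFiber Y r)) (hS : r ∉ towerMinimal Y) :
    ∃ (ψ : ℝ → G) (ς ρ : ℝ), IsFiberArc Y ψ ς ρ ∧ ψ ρ = r := by
  obtain ⟨i, ρ, hρ, rfl⟩ := hcov r
  have h0 : φ i 0 ∉ towerFiber Y (φ i ρ) := fun h =>
    eq_empty_iff_forall_notMem.1 hv _ ⟨h, mem_iUnion.2 ⟨i, Or.inl rfl⟩⟩
  have h1 : φ i 1 ∉ towerFiber Y (φ i ρ) := fun h =>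
    eq_empty_iff_forall_notMem.1 hv _ ⟨h, mem_iUnion.2 ⟨i, Or.inr rfl⟩⟩
  have hrr : φ i ρ ∈ towerFiber Y (φ i ρ) := mem_connectedComponentIn hr
  have hρ0 : 0 < ρ := lt_of_le_of_ne hρ.1 (by rintro rfl; exact h0 hrr)
  have hρ1 : ρ < 1 := lt_of_le_of_ne hρ.2 (by rintro rfl; exact h1 hrr)
  have hsub := (hφ i).subset_of_notMem le_rfl le_rfl isPreconnected_connectedComponentIn h0 h1
    ⟨hρ0, hρ1⟩ hrr
  obtain ⟨s, hs, hsf⟩ := H.tower.minimal_inter_fiber_nonempty H.graph H.cont hr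
  obtain ⟨ς, hς, rfl⟩ := hsub hsf
  rcases lt_trichotomy ς ρ with h | rfl | h
  · exact ⟨φ i, ς, ρ, H.fiberArc_of_lt (hφ i) hς.1.le h hρ.2 hs hsf hr h0 h1 h_int, rfl⟩
  · exact absurd hs hS
  · refine ⟨fun t => φ i (1 - t), 1 - ς, 1 - ρ, ?_, by simp⟩
    refine H.fiberArc_of_lt (hφ i).reverse (by linarith [hς.2]) (by linarith) (by linarith)
      ?_ ?_ ?_ ?_ ?_ ?_
    all_goals simpa

theorem isClosed_iUnion_omegaSet (H : IsConfiguration f Y E) :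
    IsClosed (⋃ a ∈ E, omegaSet f a) :=
  H.finite.isClosed_biUnion fun a _ => isClosed_omegaSet a

theorem isRegion_empty : IsRegion f Y E ∅ :=
  ⟨isOpen_empty, fun _ _ => Eventually.of_forall fun _ => notMem_empty _,
    0, fun _ _ _ _ _ _ _ ⟨_, h⟩ => absurd h.2 (notMem_empty _)⟩

theorem exists_region (H : IsConfiguration f Y E) {φ : ℝ → G} {ς ρ : ℝ}
    (hφ : IsFiberArc Y φ ς ρ) (hF : φ ρ ∉ ⋃ a ∈ E, omegaSet f a) :
    ∃ O, IsRegion f Y E O ∧ φ ρ ∈ O := by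
  have hςρ := hφ.lt
  have hς := hφ.pos
  have hρ := hφ.lt_one
  have := H.graph.1
  obtain ⟨h₀, hh₀, hF₀⟩ : ∃ h₀, ρ < h₀ ∧ ∀ t ∈ Ico ρ h₀, φ t ∉ ⋃ a ∈ E, omegaSet f a := by
    have hO := (H.isClosed_iUnion_omegaSet.preimage hφ.edge.cont).isOpen_compl
    obtain ⟨ε, hε, hball⟩ := Metric.isOpen_iff.1 hO ρ hF
    refine ⟨ρ + ε, by linarith, fun t ht => hball ?_⟩
    rw [Metric.mem_ball, Real.dist_eq, abs_lt]
    constructor <;> linarith [ht.1, ht.2]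
  obtain ⟨h, hh, hh1, hhQ⟩ := hφ.exists_notMem h₀ hh₀
  obtain ⟨N, hN⟩ := exists_forall_notMem_of_notMem_core H.tower.anti hhQ
  have hOo := hφ.edge.isOpen_image ς h hς.le hh1.le
  have hsO : φ ς ∉ φ '' Ioo ς h := by
    rintro ⟨t, ht, hts⟩
    have := hφ.edge.inj (x₁ := t) ⟨by linarith [ht.1], by linarith [ht.2]⟩
      ⟨hς.le, by linarith⟩ hts
    linarith [ht.1]
  refine ⟨φ '' Ioo ς h, ⟨hOo, ?_, N, ?_⟩, mem_image_of_mem _ ⟨hςρ, hh.1⟩⟩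
  · intro a ha
    by_contra hcon
    rw [not_eventually] at hcon
    simp only [not_not] at hcon
    rw [frequently_atTop] at hcon
    obtain ⟨p, hp, t, ht, rfl⟩ := omegaSet_nonempty_inter (f := f) (u := a)
      (hφ.edge.isClosed_image ρ h) (fun n => by
        obtain ⟨t, ht, u, hu, hut⟩ := hcon n
        refine ⟨t, ht, u, ⟨?_, hu.2.le⟩, hut⟩
        by_contra hlt
        refine H.notMem_core a ha t ?_
        rw [← hut]
        exact hφ.subset_core (mem_image_of_mem _ ⟨hu.1.le, (not_le.1 hlt).le⟩))
    exact hF₀ t ⟨ht.1, ht.2.trans_lt hh.2⟩ (mem_biUnion ha hp)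
  · rintro n hn I hIc hI hIY ⟨w, hwI, hwO, hwQ⟩ ⟨p, hpI, t₀, ht₀, rfl⟩
    have hdI : φ h ∉ I := fun hd => hN n hn (hIY hd)
    have hsI : φ ς ∈ I := by
      by_contra hsI
      exact hwO (hφ.edge.subset_of_notMem hς.le hh1.le hI hsI hdI ht₀ hpI hwI)
    have hfr : I ∩ frontier (φ '' Ioo ς h) ⊆ {φ ς} := by
      rintro q ⟨hqI, hq⟩
      rcases hφ.edge.frontier_image hς.le hh1.le hq with rfl | rfl
      · rfl
      · exact absurd hqI hdI
    have hI' := (hI.sdiff_and_inter_closure hIc hOo hfr).1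
    have hsQ : φ ς ∈ towerCore Y := hφ.subset_core (mem_image_of_mem _ ⟨le_rfl, hςρ.le⟩)
    refine ⟨hI', ⟨φ ς, hsQ, hsI, hsO⟩, ?_⟩
    obtain ⟨l, hl0, hl, hlw⟩ : ∃ l, 0 ≤ l ∧ l < ς ∧ ∀ t ∈ Ioo l ς, φ t ≠ w := by
      by_cases hw : ∃ t ∈ Ioo 0 ς, φ t = w
      · obtain ⟨l, hl, rfl⟩ := hw
        refine ⟨l, hl.1.le, hl.2, fun t ht htl => ?_⟩
        have := hφ.edge.inj (x₁ := t) ⟨by linarith [ht.1, hl.1], by linarith [ht.2]⟩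
          ⟨hl.1.le, by linarith [hl.2]⟩ htl
        linarith [ht.1]
      · push Not at hw
        exact ⟨0, le_rfl, hς, hw⟩
    have hsub : φ '' Ioo l ς ⊆ I \ φ '' Ioo ς h := by
      rintro _ ⟨ξ, hξ, rfl⟩
      by_contra hξI
      obtain ⟨u, hu, rfl⟩ := hφ.edge.subset_of_notMem (by linarith [hξ.1]) hh1.le hI' hξI
        (fun hd => hdI hd.1) ⟨hξ.2, by linarith [hh.1]⟩ ⟨hsI, hsO⟩ ⟨hwI, hwO⟩
      rcases lt_trichotomy u ς with h' | rfl | h'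
      · exact hlw u ⟨hξ.1.trans hu.1, h'⟩ rfl
      · exact hwQ hsQ
      · exact hwO (mem_image_of_mem _ ⟨h', hu.2⟩)
    obtain ⟨ξ, hξ, hξS⟩ := hφ.exists_minimal l hl
    exact ⟨φ ξ, hξS, interior_maximal hsub (hφ.edge.isOpen_image _ _ hl0 (by linarith))
      (mem_image_of_mem _ hξ)⟩

/-- Countably many regions cover all relevant points outside the limit sets. -/
theorem exists_regions (H : IsConfiguration f Y E) {n : ℕ} {φ : Fin n → ℝ → G}
    (hφ : ∀ i, IsEdge (φ i)) (hcov : ∀ p, ∃ i, ∃ t ∈ Icc (0 : ℝ) 1, φ i t = p) :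
    ∃ O : ℕ → Set G, (∀ i, IsRegion f Y E (O i)) ∧
      ∀ r ∈ towerCore Y, towerFiber Y r ∩ ⋃ i, {φ i 0, φ i 1} = ∅ →
        r ∉ interior (towerFiber Y r) → r ∉ ⋃ a ∈ E, omegaSet f a → ∃ i, r ∈ O i := by
  have := H.graph.1
  obtain ⟨T, hTc, hTs, hTu⟩ := TopologicalSpace.isOpen_sUnion_countable {O | IsRegion f Y E O}
    (fun O hO => hO.isOpen)
  obtain ⟨O, hO⟩ := (hTc.insert ∅).exists_eq_range (insert_nonempty _ _)
  refine ⟨O, fun i => ?_, fun r hr hv h_int hF => ?_⟩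
  · have : O i ∈ insert ∅ T := hO ▸ mem_range_self i
    rcases this with h | h
    · rw [h]; exact isRegion_empty
    · exact hTs h
  · obtain ⟨a, ha⟩ := H.nonempty
    have hS : r ∉ towerMinimal Y := fun h =>
      hF (mem_biUnion ha (H.tower.minimal_subset_omegaSet (H.attracted a ha) h))
    obtain ⟨ψ, ς, ρ, hψ, rfl⟩ := H.exists_fiberArc hφ hcov hr hv h_int hS
    obtain ⟨U, hU, hrU⟩ := H.exists_region hψ hF
    have : ψ ρ ∈ ⋃₀ T := by rw [hTu]; exact ⟨U, hU, hrU⟩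
    obtain ⟨V, hV, hrV⟩ := this
    have : V ∈ range O := hO ▸ mem_insert_of_mem _ hV
    obtain ⟨i, rfl⟩ := this
    exact ⟨i, hrV⟩

/-- Near a point of a limit set there are windows, visited infinitely often, to which continua can
be restricted. -/
theorem exists_window (H : IsConfiguration f Y E) {n : ℕ} {φ : Fin n → ℝ → G}
    (hφ : ∀ i, IsEdge (φ i)) (hcov : ∀ p, ∃ i, ∃ t ∈ Icc (0 : ℝ) 1, φ i t = p) {a e : G}
    (ha : a ∈ E) (he : e ∈ omegaSet f a) (heS : e ∉ towerMinimal Y)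
    (hv : towerFiber Y e ∩ ⋃ i, {φ i 0, φ i 1} = ∅) {ε : ℝ} (hε : 0 < ε) :
    ∃ (T : Set G) (N : ℕ), (∀ m, ∃ t ≥ m, f^[t] a ∈ T) ∧ ∀ J : Set G, IsClosed J →
      IsPreconnected J → J ⊆ Y N → ∀ w ∈ J, w ∈ T → (J ∩ towerCore Y).Nonempty →
      ∃ I ⊆ J, IsClosed I ∧ IsPreconnected I ∧ w ∈ I ∧ (I ∩ towerCore Y).Nonempty ∧
        I ⊆ Metric.ball e ε := by
  have heQ := H.tower.omegaSet_subset_core (H.attracted a ha) he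
  obtain ⟨ψ, ς, ρ, hψ, rfl⟩ := H.exists_fiberArc hφ hcov heQ hv
    (H.tower.omegaSet_inter_interior_fiber he) heS
  have hςρ := hψ.lt
  have hς := hψ.pos
  have hρ := hψ.lt_one
  obtain ⟨h₀, hh₀, hball⟩ : ∃ h₀, ρ < h₀ ∧ ∀ t ∈ Ico ρ h₀, ψ t ∈ Metric.ball (ψ ρ) ε := by
    obtain ⟨δ, hδ, hb⟩ := Metric.isOpen_iff.1
      ((Metric.isOpen_ball (x := ψ ρ) (ε := ε)).preimage hψ.edge.cont) ρ (Metric.mem_ball_self hε)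
    refine ⟨ρ + δ, by linarith, fun t ht => hb ?_⟩
    rw [Metric.mem_ball, Real.dist_eq, abs_lt]
    constructor <;> linarith [ht.1, ht.2]
  obtain ⟨h, hh, hh1, hhQ⟩ := hψ.exists_notMem h₀ hh₀
  obtain ⟨N, hN⟩ := exists_forall_notMem_of_notMem_core H.tower.anti hhQ
  have hρ0 : 0 ≤ ρ := (hς.trans hςρ).le
  have hTo := hψ.edge.isOpen_image ρ h hρ0 hh1.le
  have hTb : closure (ψ '' Ioo ρ h) ⊆ Metric.ball (ψ ρ) ε := by
    refine (hψ.edge.closure_image ρ h).trans ?_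
    rintro _ ⟨t, ht, rfl⟩
    exact hball t ⟨ht.1, ht.2.trans_lt hh.2⟩
  refine ⟨ψ '' Ioo ρ h, N, fun m => ?_, ?_⟩
  · obtain ⟨t, ht, u, hu, hut⟩ := mem_omegaSet_iff.1 he _ (hψ.edge.isOpen_image ς h hς.le hh1.le)
      (mem_image_of_mem _ ⟨hςρ, hh.1⟩) m
    refine ⟨t, ht, u, ⟨?_, hu.2⟩, hut⟩
    by_contra hlt
    refine H.notMem_core a ha t ?_
    rw [← hut]
    exact hψ.subset_core (mem_image_of_mem _ ⟨hu.1.le, not_lt.1 hlt⟩)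
  · rintro J hJc hJ hJY w hwJ ⟨t, ht, rfl⟩ hJQ
    have hdJ : ψ h ∉ J := fun hd => hN N le_rfl (hJY hd)
    by_cases heJ : ψ ρ ∈ J
    · have hfr : J ∩ frontier (ψ '' Ioo ρ h) ⊆ {ψ ρ} := by
        rintro q ⟨hqJ, hq⟩
        rcases hψ.edge.frontier_image hρ0 hh1.le hq with rfl | rfl
        · rfl
        · exact absurd hqJ hdJ
      refine ⟨J ∩ closure (ψ '' Ioo ρ h), inter_subset_left, hJc.inter isClosed_closure,
        (hJ.sdiff_and_inter_closure hJc hTo hfr).2,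
        ⟨hwJ, subset_closure (mem_image_of_mem _ ht)⟩, ⟨ψ ρ, ⟨heJ, ?_⟩, heQ⟩,
        inter_subset_right.trans hTb⟩
      refine image_closure_subset_closure_image hψ.edge.cont (mem_image_of_mem _ ?_)
      rw [closure_Ioo hh.1.ne]
      exact ⟨le_rfl, hh.1.le⟩
    · refine ⟨J, Subset.rfl, hJc, hJ, hwJ, hJQ, ?_⟩
      exact (hψ.edge.subset_of_notMem hρ0 hh1.le hJ heJ hdJ ht hwJ).trans
        (subset_closure.trans hTb)

end IsConfiguration

/-- `J` is the image under `f^[k]` of a compact part of `I` consisting of points whose first `k`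
iterates avoid `V`. -/
def Reach {G : Type*} [TopologicalSpace G] (f : G → G) (V : Set G) (k : ℕ) (I J : Set G) : Prop :=
  ∃ C ⊆ I, IsCompact C ∧ f^[k] '' C = J ∧ ∀ z ∈ C, ∀ t ≤ k, f^[t] z ∉ V

/-- A subcontinuum of `Y n` meeting the core and containing the `τ`-th iterate of `a`. -/
structure IsTracker {G : Type*} [TopologicalSpace G] (f : G → G) (Y : ℕ → Set G) (n : ℕ)
    (a : G) (τ : ℕ) (I : Set G) : Prop where
  closed : IsClosed I
  preconnected : IsPreconnected I
  subset : I ⊆ Y n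
  mem : f^[τ] a ∈ I
  core : (I ∩ towerCore Y).Nonempty

/-- From time `τ₀` on, continua tracking the orbit of `a` can be made disjoint from `V`, and if this
changes them then they retain a part of the minimal set in the interior. -/
def CutsOff {G : Type*} [TopologicalSpace G] (f : G → G) (Y : ℕ → Set G) (n : ℕ) (V : Set G)
    (a : G) (τ₀ : ℕ) : Prop :=
  ∀ τ ≥ τ₀, ∀ I, IsTracker f Y n a τ I → ∃ J ⊆ I, IsTracker f Y n a τ J ∧ J ∩ V = ∅ ∧
    (J = I ∨ (towerMinimal Y ∩ interior J).Nonempty)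

section Reach

variable {G : Type*} [TopologicalSpace G] {f : G → G} {V I J K : Set G} {k l : ℕ}

theorem Reach.trans_mem [T2Space G] (hf : Continuous f) (h₁ : Reach f V k I J)
    (h₂ : Reach f V l J K) :
    ∃ C ⊆ I, IsCompact C ∧ f^[k + l] '' C = K ∧ (∀ z ∈ C, ∀ t ≤ k + l, f^[t] z ∉ V) ∧
      ∀ z ∈ C, f^[k] z ∈ J := by
  obtain ⟨C, hCI, hC, hCJ, hCV⟩ := h₁
  obtain ⟨D, hDJ, hD, hDK, hDV⟩ := h₂
  refine ⟨C ∩ f^[k] ⁻¹' D, inter_subset_left.trans hCI,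
    hC.inter_right (hD.isClosed.preimage (hf.iterate k)), ?_, ?_, fun z hz => hDJ hz.2⟩
  · rw [add_comm, Function.iterate_add, image_comp, image_inter_preimage, hCJ,
      inter_eq_right.2 hDJ, hDK]
  · intro z hz t ht
    by_cases htk : t ≤ k
    · exact hCV z hz.1 t htk
    · have := hDV _ hz.2 (t - k) (by omega)
      rwa [← Function.iterate_add_apply, Nat.sub_add_cancel (by omega)] at this

theorem Reach.trans [T2Space G] (hf : Continuous f) (h₁ : Reach f V k I J)
    (h₂ : Reach f V l J K) : Reach f V (k + l) I K := by
  obtain ⟨C, h1, h2, h3, h4, -⟩ := h₁.trans_mem hf h₂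
  exact ⟨C, h1, h2, h3, h4⟩

theorem Reach.of_subset (hJ : IsCompact J) (hJI : J ⊆ I) (hJV : J ∩ V = ∅) : Reach f V 0 I J :=
  ⟨J, hJI, hJ, by simp, fun z hz t ht => by
    obtain rfl : t = 0 := by omega
    exact fun h => eq_empty_iff_forall_notMem.1 hJV z ⟨hz, h⟩⟩

theorem Reach.of_subset_image [T2Space G] (hf : Continuous f) (hI : IsCompact I) (hJ : IsClosed J)
    (hJI : J ⊆ f '' I) (hIV : I ∩ V = ∅) (hJV : J ∩ V = ∅) : Reach f V 1 I J := by
  refine ⟨I ∩ f ⁻¹' J, inter_subset_left, hI.inter_right (hJ.preimage hf), ?_, ?_⟩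
  · rw [Function.iterate_one, image_inter_preimage, inter_eq_right.2 hJI]
  · rintro z ⟨hz, hz'⟩ t ht h
    obtain rfl | rfl : t = 0 ∨ t = 1 := by omega
    · exact eq_empty_iff_forall_notMem.1 hIV z ⟨hz, h⟩
    · exact eq_empty_iff_forall_notMem.1 hJV _ ⟨hz', h⟩

end Reach

/-- A sequence of relations `f^[k m] (C m) = D (m + 1)` with `C m ⊆ D m` is realised by an orbit. -/
theorem exists_forall_iterate_mem {G : Type*} [TopologicalSpace G] [CompactSpace G] [T2Space G]
    {f : G → G} (hf : Continuous f) {C D : ℕ → Set G} {k : ℕ → ℕ} (hC : ∀ m, IsClosed (C m))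
    (hCD : ∀ m, C m ⊆ D m) (hk : ∀ m, f^[k m] '' C m = D (m + 1)) (hD : ∀ m, (D m).Nonempty) :
    ∃ z, ∀ m, f^[∑ i ∈ Finset.range m, k i] z ∈ C m := by
  set T : ℕ → ℕ := fun m => ∑ i ∈ Finset.range m, k i with hT
  have hTs : ∀ m, T (m + 1) = k m + T m := fun m => by
    rw [hT]; simp only [Finset.sum_range_succ]; ring
  set A : ℕ → Set G := fun m => ⋂ i < m, f^[T i] ⁻¹' C i with hA
  have hAs : ∀ m, A (m + 1) = A m ∩ f^[T m] ⁻¹' C m := fun m => by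
    rw [hA]; simp only [Order.lt_add_one_iff]
    ext z
    simp only [mem_iInter, mem_inter_iff]
    constructor
    · exact fun h => ⟨fun i hi => h i hi.le, h m le_rfl⟩
    · rintro ⟨h1, h2⟩ i hi
      rcases eq_or_lt_of_le hi with rfl | hi
      · exact h2
      · exact h1 i hi
  have hAD : ∀ m, D m ⊆ f^[T m] '' A m := by
    intro m
    induction m with
    | zero =>
      intro z hz
      exact ⟨z, by simp [hA], by simp [hT]⟩
    | succ m ih =>
      rw [hAs, hTs, Function.iterate_add, image_comp, image_inter_preimage, ← hk m]
      exact image_mono (subset_inter ((hCD m).trans ih) Subset.rfl)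
  have hCl : ∀ m, IsClosed (A m) := fun m =>
    isClosed_biInter fun i _ => (hC i).preimage (hf.iterate _)
  have hDn : ∀ m, (A m).Nonempty := fun m => ((hD m).mono (hAD m)).of_image
  obtain ⟨z, hz⟩ := IsCompact.nonempty_iInter_of_sequence_nonempty_isCompact_isClosed A
    (fun m => by rw [hAs]; exact inter_subset_left) hDn (hCl 0).isCompact hCl
  refine ⟨z, fun m => ?_⟩
  have := mem_iInter.1 hz (m + 1)
  rw [hAs] at this
  exact this.2

namespace IsTracker

variable {G : Type*} [TopologicalSpace G] {f : G → G} {Y : ℕ → Set G} {n : ℕ} {a : G} {τ : ℕ}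
  {I : Set G}

theorem image [CompactSpace G] [T2Space G] (hY : IsTower f Y) (hf : Continuous f)
    (hI : IsTracker f Y n a τ I) : IsTracker f Y n a (τ + 1) (f '' I) := by
  refine ⟨(hI.closed.isCompact.image hf).isClosed, hI.preconnected.image _ hf.continuousOn, ?_,
    ?_, ?_⟩
  · rintro _ ⟨p, hp, rfl⟩
    exact hY.mapsTo n (hI.subset hp)
  · rw [Function.iterate_succ_apply']
    exact mem_image_of_mem _ hI.mem
  · obtain ⟨q, hq, hqc⟩ := hI.core
    exact ⟨f q, mem_image_of_mem _ hq, hY.mapsTo_core hqc⟩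

/-- Trackers can be followed along the orbit, avoiding `V`. -/
theorem exists_reach [CompactSpace G] [T2Space G] (hY : IsTower f Y) (hf : Continuous f)
    {V : Set G} {τ₀ : ℕ} (hcut : CutsOff f Y n V a τ₀) (hτ : τ₀ ≤ τ) (hI : IsTracker f Y n a τ I)
    (hIV : I ∩ V = ∅) (j : ℕ) : ∃ J, IsTracker f Y n a (τ + j) J ∧ Reach f V j I J ∧ J ∩ V = ∅ ∧
      (J = f^[j] '' I ∨ ∃ k K, Reach f V k I K ∧ (towerMinimal Y ∩ interior K).Nonempty) := by
  induction j with
  | zero => exact ⟨I, hI, Reach.of_subset hI.closed.isCompact Subset.rfl hIV, hIV, Or.inl (by simp)⟩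
  | succ j ih =>
    obtain ⟨J, hJ, hR, hJV, hor⟩ := ih
    obtain ⟨K, hKJ, hK, hKV, hor'⟩ := hcut (τ + j + 1) (by omega) _ (hJ.image hY hf)
    have hRK : Reach f V (j + 1) I K := hR.trans hf
      (Reach.of_subset_image hf hJ.closed.isCompact hK.closed hKJ hJV hKV)
    refine ⟨K, hK, hRK, hKV, ?_⟩
    rcases hor' with rfl | h
    · rcases hor with rfl | h
      · left
        rw [Function.iterate_succ', image_comp]
      · exact Or.inr h
    · exact Or.inr ⟨_, K, hRK, h⟩

end IsTracker

/-- Finitely many cuttable open sets can be cut off from a tracker. -/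
theorem exists_isTracker_forall_inter_eq_empty {G : Type*} [TopologicalSpace G] {f : G → G}
    {Y : ℕ → Set G} {n : ℕ} {a : G} {τ : ℕ} {I : Set G} {O : ℕ → Set G} {m : ℕ}
    (ho : ∀ i < m, IsOpen (O i)) (hcut : ∀ i < m, IsCuttable Y n (O i))
    (ha : ∀ i < m, f^[τ] a ∉ O i) (hac : f^[τ] a ∉ towerCore Y) (hI : IsTracker f Y n a τ I) :
    ∃ J ⊆ I, IsTracker f Y n a τ J ∧ (∀ i < m, J ∩ O i = ∅) ∧
      (J = I ∨ (towerMinimal Y ∩ interior J).Nonempty) := by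
  induction m with
  | zero => exact ⟨I, Subset.rfl, hI, by simp, Or.inl rfl⟩
  | succ m ih =>
    obtain ⟨J, hJI, hJ, hJO, hor⟩ :=
      ih (fun i hi => ho i (by omega)) (fun i hi => hcut i (by omega))
      (fun i hi => ha i (by omega))
    rcases eq_empty_or_nonempty (J ∩ O m) with h | h
    · refine ⟨J, hJI, hJ, fun i hi => ?_, hor⟩
      rcases eq_or_lt_of_le (Nat.lt_succ_iff.1 hi) with rfl | hi
      · exact h
      · exact hJO i hi
    · obtain ⟨h1, ⟨q, hq, hqJ⟩, h3⟩ := hcut m (by omega) J hJ.closed hJ.preconnected hJ.subset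
        ⟨_, hJ.mem, ha m (by omega), hac⟩ h
      refine ⟨J \ O m, sdiff_subset.trans hJI, ⟨hJ.closed.sdiff (ho m (by omega)), h1,
        sdiff_subset.trans hJ.subset, ⟨hJ.mem, ha m (by omega)⟩, ⟨q, hqJ, hq⟩⟩, fun i hi => ?_,
        Or.inr h3⟩
      rcases eq_or_lt_of_le (Nat.lt_succ_iff.1 hi) with rfl | hi
      · exact sdiff_inter_self
      · rw [← subset_empty_iff, ← hJO i hi]
        exact inter_subset_inter_left _ sdiff_subset

theorem IsConfiguration.exists_cutsOff {G : Type*} [MetricSpace G] {f : G → G} {Y : ℕ → Set G}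
    {E : Set G} (H : IsConfiguration f Y E) {O : ℕ → Set G} (hO : ∀ i, IsRegion f Y E (O i))
    (m : ℕ) : ∃ N₀, ∀ n ≥ N₀, ∀ a ∈ E, ∃ τ₀, CutsOff f Y n ((⋃ i < m, O i) ∪ (Y n)ᶜ) a τ₀ := by
  choose N hN using fun i => (hO i).cut
  refine ⟨∑ i ∈ Finset.range m, N i, fun n hn a ha => ?_⟩
  have h1 : ∀ i < m, IsCuttable Y n (O i) := fun i hi =>
    hN i n (le_trans (Finset.single_le_sum (fun _ _ => Nat.zero_le _) (Finset.mem_range.2 hi)) hn)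
  have h2 : ∀ᶠ t in atTop, ∀ i ∈ Iio m, f^[t] a ∉ O i :=
    (finite_Iio m).eventually_all.2 fun i _ => (hO i).avoid a ha
  obtain ⟨τ₀, hτ₀⟩ := eventually_atTop.1 h2
  refine ⟨τ₀, fun τ hτ I hI => ?_⟩
  obtain ⟨J, hJI, hJ, hJO, hor⟩ := exists_isTracker_forall_inter_eq_empty
    (fun i _ => (hO i).isOpen) h1 (hτ₀ τ hτ) (H.notMem_core a ha τ) hI
  refine ⟨J, hJI, hJ, ?_, hor⟩
  rw [eq_empty_iff_forall_notMem]
  rintro p ⟨hp, hp' | hp'⟩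
  · simp only [mem_iUnion] at hp'
    obtain ⟨i, hi, hpi⟩ := hp'
    exact eq_empty_iff_forall_notMem.1 (hJO i hi) p ⟨hp, hpi⟩
  · exact hp' (hJ.subset hp)

/-- The minimal set has no relatively open nonempty countable subsets. -/
theorem IsTower.not_countable_minimal_inter {G : Type*} [MetricSpace G] {f : G → G}
    {Y : ℕ → Set G} (hY : IsTower f Y) (hG : IsTopGraph G) (hf : Continuous f) {q : G}
    (hq : q ∈ towerCore Y) {O : Set G} (hO : IsOpen O) (hne : (towerMinimal Y ∩ O).Nonempty) :
    ¬ (towerMinimal Y ∩ O).Countable := by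
  intro hcount
  have := hG.1
  have hcl := hY.isClosed_minimal hG hq
  have hperf : Perfect (towerMinimal Y) := by
    refine ⟨hcl, preperfect_iff_nhds.2 fun s hs U hU => ?_⟩
    obtain ⟨U', hU', hU'o, hsU'⟩ := mem_nhds_iff.1 hU
    have hsc := hY.minimal_subset_core hG hq hs
    obtain ⟨s', hs', hs'U, hs's⟩ := hY.exists_iterate_minimal_mem hG hf hs hsc hU'o hsU'
    refine ⟨s', ⟨hU' hs'U, hs'⟩, ?_⟩
    rintro rfl
    exact hs's (mem_connectedComponentIn hsc)
  obtain ⟨s, hs, hsO⟩ := hne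
  obtain ⟨ε, hε, hball⟩ := Metric.isOpen_iff.1 hO s hsO
  obtain ⟨hp, hpn⟩ := hperf.closure_nhds_inter s hs (Metric.mem_ball_self (half_pos hε))
    Metric.isOpen_ball
  obtain ⟨g, hg, -, hginj⟩ := hp.exists_nat_bool_injection hpn
  have hsub : closure (Metric.ball s (ε / 2) ∩ towerMinimal Y) ⊆ towerMinimal Y ∩ O := by
    intro p hp
    refine ⟨closure_minimal inter_subset_right hcl hp, hball ?_⟩
    have := Metric.closure_ball_subset_closedBall (closure_mono inter_subset_left hp)
    rw [Metric.mem_closedBall] at this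
    rw [Metric.mem_ball]
    linarith
  have hc : (range g).Countable := hcount.mono (hg.trans hsub)
  obtain ⟨k, hk⟩ := countable_iff_exists_injOn.1 hc
  classical
  refine Function.cantor_injective (fun A : Set ℕ => k (g fun i => decide (i ∈ A)))
    fun A B hAB => ?_
  have h := hginj (hk (mem_range_self _) (mem_range_self _) hAB)
  ext i
  simpa using congrFun h i

/-- A tracker of an orbit with a large limit set can reach a set containing a part of the minimal
set in its interior. -/
theorem IsConfiguration.exists_reach_minimal {G : Type*} [MetricSpace G] {f : G → G}
    {Y : ℕ → Set G} {E : Set G} (H : IsConfiguration f Y E) {a : G} (ha : a ∈ E) {n : ℕ}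
    {V : Set G} {τ₀ τ : ℕ} (hcut : CutsOff f Y n V a τ₀) (hτ : τ₀ ≤ τ) {I : Set G}
    (hI : IsTracker f Y n a τ I) (hIV : I ∩ V = ∅) :
    ∃ k K, Reach f V k I K ∧ (towerMinimal Y ∩ interior K).Nonempty := by
  have := H.graph.1
  have hY := H.tower
  have hf := H.cont
  by_contra hgood
  have htr : ∀ j, IsTracker f Y n a (τ + j) (f^[j] '' I) := by
    intro j
    obtain ⟨J, hJ, -, -, rfl | h⟩ := hI.exists_reach hY hf hcut hτ hIV j
    · exact hJ
    · exact absurd h hgood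
  have hemp : ∀ j, ¬ (towerMinimal Y ∩ interior (f^[j] '' I)).Nonempty := by
    intro j h
    obtain ⟨J, -, hR, -, rfl | h⟩ := hI.exists_reach hY hf hcut hτ hIV j
    · exact hgood ⟨j, _, hR, h⟩
    · exact hgood h
  obtain ⟨q, hqI, hq⟩ := hI.core
  obtain ⟨ε, hε, hbig⟩ : ∃ ε > 0, ∃ᶠ j in atTop,
      ¬ ∀ p ∈ f^[j] '' I, ∀ p' ∈ f^[j] '' I, dist p p' ≤ ε := by
    by_contra! hcon
    apply H.not_subset a ha
    rw [← hY.omegaSet_eq_minimal H.graph hq]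
    intro σ hσ
    rw [mem_omegaSet_iff]
    intro O hO hσO N
    obtain ⟨ε, hε, hball⟩ := Metric.isOpen_iff.1 hO σ hσO
    have h1 := hcon (ε / 2) (half_pos hε)
    obtain ⟨M, hM⟩ := eventually_atTop.1 h1
    obtain ⟨t, ht, htO⟩ := mem_omegaSet_iff.1 hσ _ Metric.isOpen_ball
      (Metric.mem_ball_self (half_pos hε)) (τ + M + N)
    refine ⟨t - τ, by omega, hball ?_⟩
    have h2 := hM (t - τ) (by omega) _ (mem_image_of_mem _ hqI) _ (htr (t - τ)).mem
    rw [Nat.add_sub_of_le (by omega)] at h2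
    rw [Metric.mem_ball] at htO ⊢
    linarith [dist_triangle (f^[t - τ] q) (f^[t] a) σ]
  obtain ⟨P, hP, hPcut⟩ := H.graph.exists_finite_cut hε
  obtain ⟨v, -, hv⟩ : ∃ v ∈ P, ∃ᶠ j in atTop, v ∈ f^[j] '' I := by
    rw [← frequently_exists_finite hP]
    refine hbig.mono fun j hj => ?_
    rcases hPcut _ (htr j).preconnected with ⟨v, h1, h2⟩ | h
    · exact ⟨v, h2, h1⟩
    · exact absurd h hj
  set U : Set G := ⋃₀ {A | ∃ j, v ∈ f^[j] '' I ∧ A = f^[j] '' I} with hU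
  have hUpre : IsPreconnected U := by
    refine isPreconnected_sUnion v _ ?_ ?_
    · rintro _ ⟨j, hj, rfl⟩
      exact hj
    · rintro _ ⟨j, hj, rfl⟩
      exact (htr j).preconnected
  obtain ⟨N, hN⟩ := exists_forall_ge_inter_eq_empty (H.graph.finite_frontier_s4 hUpre)
    (fun i j hij => hY.disjoint_fiber_iterate hq hij)
  obtain ⟨j, hjN, hvj⟩ := frequently_atTop.1 hv N
  have hqj := hY.mapsTo_core.iterate j hq
  have hqU : f^[j] q ∈ U := ⟨_, ⟨j, hvj, rfl⟩, mem_image_of_mem _ hqI⟩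
  have hqf : f^[j] q ∈ towerFiber Y (f^[j] q) := mem_connectedComponentIn hqj
  have hempty := hN j hjN
  have hqint : f^[j] q ∈ interior U := by
    by_contra h
    exact eq_empty_iff_forall_notMem.1 hempty _ ⟨hqf, subset_closure hqU, h⟩
  have hsub : towerFiber Y (f^[j] q) ⊆ interior U := by
    refine isPreconnected_connectedComponentIn.subset_of_inter_frontier_eq_empty isOpen_interior
      ⟨_, hqf, hqint⟩ ?_
    rw [← subset_empty_iff, ← hempty]
    exact inter_subset_inter_right _ frontier_interior_subset
  obtain ⟨s, hs, hsf⟩ := hY.minimal_inter_fiber_nonempty H.graph hf hqj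
  refine hY.not_countable_minimal_inter H.graph hf hq isOpen_interior ⟨s, hs, hsub hsf⟩ ?_
  refine (countable_iUnion fun i => (H.graph.finite_frontier_s4 (htr i).preconnected).countable).mono
    ?_
  rintro p ⟨hp, hpU⟩
  obtain ⟨_, ⟨i, -, rfl⟩, hpi⟩ := interior_subset hpU
  refine mem_iUnion.2 ⟨i, subset_closure hpi, fun h => hemp i ⟨p, hp, h⟩⟩

namespace IsConfiguration

variable {G : Type*} [MetricSpace G] {f : G → G} {Y : ℕ → Set G} {E : Set G}

/-- Starting from a component of a level of the tower, one can visit a window and then come back to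
a set containing a part of the minimal set in its interior. -/
theorem exists_excursion (H : IsConfiguration f Y E) {a : G} (ha : a ∈ E) {N : ℕ} {V T B : Set G}
    {τ₀ : ℕ} (hcut : CutsOff f Y N V a τ₀) (hT : ∀ m, ∃ t ≥ m, f^[t] a ∈ T)
    (hwin : ∀ J : Set G, IsClosed J → IsPreconnected J → J ⊆ Y N → ∀ w ∈ J, w ∈ T →
      (J ∩ towerCore Y).Nonempty → ∃ I ⊆ J, IsClosed I ∧ IsPreconnected I ∧ w ∈ I ∧
        (I ∩ towerCore Y).Nonempty ∧ I ⊆ B)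
    {n : ℕ} (hn : N ≤ n) {q : G} (hq : q ∈ towerCore Y) :
    ∃ k ≥ 1, ∃ C ⊆ connectedComponentIn (Y n) q, IsClosed C ∧
      (towerMinimal Y ∩ interior (f^[k] '' C)).Nonempty ∧ (∀ z ∈ C, ∀ t ≤ k, f^[t] z ∉ V) ∧
      ∀ z ∈ C, ∃ t ≤ k, f^[t] z ∈ B := by
  have := H.graph.1
  have hY := H.tower
  have hf := H.cont
  obtain ⟨σ, hσ⟩ := eventually_atTop.1 (H.attracted a ha n)
  obtain ⟨t, ht, htD⟩ := hY.visit n _ (hσ σ le_rfl) q (mem_iInter.1 hq n) τ₀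
  rw [← Function.iterate_add_apply] at htD
  have hD : IsTracker f Y N a (t + σ) (connectedComponentIn (Y n) q) :=
    ⟨isClosed_connectedComponentIn (hY.closed n) q, isPreconnected_connectedComponentIn,
      (connectedComponentIn_subset _ _).trans (hY.anti hn), htD,
      ⟨q, mem_connectedComponentIn (mem_iInter.1 hq n), hq⟩⟩
  obtain ⟨D₁, hD₁D, hD₁, hD₁V, -⟩ := hcut (t + σ) (by omega) _ hD
  obtain ⟨s, hs, hsT⟩ := hT (t + σ + 1)
  obtain ⟨J, hJ, hR, hJV, -⟩ := hD₁.exists_reach hY hf hcut (by omega) hD₁V (s - (t + σ))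
  rw [Nat.add_sub_of_le (by omega)] at hJ
  obtain ⟨I, hIJ, hIc, hIp, hIw, hIQ, hIB⟩ := hwin J hJ.closed hJ.preconnected hJ.subset _ hJ.mem
    hsT hJ.core
  have hIV : I ∩ V = ∅ := by
    rw [← subset_empty_iff, ← hJV]
    exact inter_subset_inter_left _ hIJ
  have hI : IsTracker f Y N a s I := ⟨hIc, hIp, hIJ.trans hJ.subset, hIw, hIQ⟩
  obtain ⟨l, K, hRK, hK⟩ := H.exists_reach_minimal ha hcut (by omega) hI hIV
  obtain ⟨C, hCD, hC, rfl, hCV, hCI⟩ :=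
    (hR.trans hf (Reach.of_subset hIc.isCompact hIJ hIV)).trans_mem hf hRK
  exact ⟨_, by omega, C, hCD.trans hD₁D, hC.isClosed, hK, hCV,
    fun z hz => ⟨_, by omega, hIB (hCI z hz)⟩⟩

/-- There is an orbit attracted by the tower, eventually avoiding given regions, and visiting
smaller and smaller neighbourhoods of given points. -/
theorem exists_orbit (H : IsConfiguration f Y E) {n : ℕ} {φ : Fin n → ℝ → G}
    (hφ : ∀ i, IsEdge (φ i)) (hcov : ∀ p, ∃ i, ∃ t ∈ Icc (0 : ℝ) 1, φ i t = p) {O : ℕ → Set G}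
    (hO : ∀ i, IsRegion f Y E (O i)) {e : ℕ → G}
    (he : ∀ m, ∃ a ∈ E, e m ∈ omegaSet f a) (heS : ∀ m, e m ∉ towerMinimal Y)
    (hev : ∀ m, towerFiber Y (e m) ∩ ⋃ i, {φ i 0, φ i 1} = ∅) :
    ∃ z, IsAttracted f Y z ∧ (∀ i, ∀ᶠ t in atTop, f^[t] z ∉ O i) ∧
      ∀ m : ℕ, ∃ t ≥ m, dist (f^[t] z) (e m) < 1 / ((m : ℝ) + 1) := by
  have := H.graph.1
  have hY := H.tower
  choose a ha hea using he
  choose T N₁ hT hwin using fun m => H.exists_window hφ hcov (ha m) (hea m) (heS m) (hev m)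
    (Nat.one_div_pos_of_nat (α := ℝ) (n := m))
  choose N₂ hN₂ using H.exists_cutsOff hO
  set N : ℕ → ℕ := fun m => max (max (N₁ m) (N₂ m)) m with hN
  choose τ hτ using fun m => hN₂ m (N m) ((le_max_right _ _).trans (le_max_left _ _)) (a m) (ha m)
  have step : ∀ m (s : {s : ℕ × G // N m ≤ s.1 ∧ s.2 ∈ towerCore Y}),
      ∃ (s' : {s : ℕ × G // N (m + 1) ≤ s.1 ∧ s.2 ∈ towerCore Y}) (k : ℕ) (C : Set G), 1 ≤ k ∧
        C ⊆ connectedComponentIn (Y s.1.1) s.1.2 ∧ IsClosed C ∧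
        f^[k] '' C = connectedComponentIn (Y s'.1.1) s'.1.2 ∧
        (∀ z ∈ C, ∀ t ≤ k, f^[t] z ∉ (⋃ i < m, O i) ∪ (Y (N m))ᶜ) ∧
        ∀ z ∈ C, ∃ t ≤ k, f^[t] z ∈ Metric.ball (e m) (1 / ((m : ℝ) + 1)) := by
    rintro m ⟨⟨l, q⟩, hl, hq⟩
    obtain ⟨k, hk, C, hC, hCc, ⟨σ, hσ, hσC⟩, hCV, hCB⟩ := H.exists_excursion (ha m) (hτ m) (hT m)
      (fun J h1 h2 h3 => hwin m J h1 h2 (h3.trans (hY.anti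
        ((le_max_left _ _).trans (le_max_left _ _))))) hl hq
    obtain ⟨q', hq', hq'C⟩ := hσ _ isOpen_interior hσC
    obtain ⟨l', hl'⟩ := hY.exists_component_subset hq' isOpen_interior hq'C
    have hl'' := (hl' (max l' (N (m + 1))) (le_max_left _ _)).trans interior_subset
    refine ⟨⟨⟨max l' (N (m + 1)), q'⟩, le_max_right _ _, hq'⟩, k,
      C ∩ f^[k] ⁻¹' connectedComponentIn (Y (max l' (N (m + 1)))) q', hk,
      inter_subset_left.trans hC,
      hCc.inter ((isClosed_connectedComponentIn (hY.closed _) _).preimage (H.cont.iterate k)), ?_,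
      fun z hz => hCV z hz.1, fun z hz => hCB z hz.1⟩
    rw [image_inter_preimage, inter_eq_right.2 hl'']
  choose next k C hk hCD hC hCk hCV hCB using step
  obtain ⟨q₀, hq₀⟩ : (towerCore Y).Nonempty :=
    ⟨e 0, hY.omegaSet_subset_core (H.attracted _ (ha 0)) (hea 0)⟩
  let s : ∀ m, {s : ℕ × G // N m ≤ s.1 ∧ s.2 ∈ towerCore Y} := fun m =>
    Nat.rec ⟨⟨N 0, q₀⟩, le_rfl, hq₀⟩ (fun m s => next m s) m
  obtain ⟨z, hz⟩ := exists_forall_iterate_mem H.cont (fun m => hC m (s m)) (fun m => hCD m (s m))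
    (fun m => hCk m (s m))
    (fun m => ⟨_, mem_connectedComponentIn (mem_iInter.1 (s m).2.2 (s m).1.1)⟩)
  set S : ℕ → ℕ := fun m => ∑ i ∈ Finset.range m, k i (s i) with hS
  have hSs : ∀ m, S (m + 1) = S m + k m (s m) := fun m => Finset.sum_range_succ _ _
  have hSm : ∀ m, m ≤ S m := by
    intro m
    induction m with
    | zero => exact Nat.zero_le _
    | succ m ih => have := hk m (s m); rw [hSs]; omega
  have hav : ∀ m, ∀ t ≥ S m, ∃ l ≥ m, f^[t] z ∉ (⋃ i < l, O i) ∪ (Y (N l))ᶜ := by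
    intro m t ht
    obtain ⟨j, hj, hj'⟩ : ∃ j, t ≤ S (m + j + 1) ∧ S (m + j) ≤ t := by
      have hex : ∃ j, t < S (m + j + 1) := ⟨t, by have := hSm (m + t + 1); omega⟩
      classical
      refine ⟨Nat.find hex, (Nat.find_spec hex).le, ?_⟩
      rcases Nat.eq_zero_or_eq_succ_pred (Nat.find hex) with h0 | h0
      · rw [h0]; exact ht
      · have := Nat.find_min hex (m := (Nat.find hex).pred) (by omega)
        rw [not_lt, add_assoc, ← Nat.succ_eq_add_one, ← h0] at this
        exact this
    refine ⟨m + j, by omega, ?_⟩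
    have := hCV (m + j) (s (m + j)) _ (hz (m + j)) (t - S (m + j))
      (by have := hSs (m + j); omega)
    rwa [← Function.iterate_add_apply, Nat.sub_add_cancel hj'] at this
  refine ⟨z, fun m => ?_, fun i => ?_, fun m => ?_⟩
  · refine eventually_atTop.2 ⟨S m, fun t ht => ?_⟩
    obtain ⟨l, hl, h⟩ := hav m t ht
    by_contra hcon
    exact h (Or.inr fun h' => hcon (hY.anti (hl.trans (le_max_right _ _)) h'))
  · refine eventually_atTop.2 ⟨S (i + 1), fun t ht hcon => ?_⟩
    obtain ⟨l, hl, h⟩ := hav (i + 1) t ht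
    exact h (Or.inl (mem_iUnion₂.2 ⟨i, by omega, hcon⟩))
  · obtain ⟨t, -, ht⟩ := hCB m (s m) _ (hz m)
    rw [← Function.iterate_add_apply] at ht
    exact ⟨_, (hSm m).trans (Nat.le_add_left _ _), ht⟩

/-- The union of the limit sets of a configuration is a limit set. -/
theorem exists_omegaSet_eq (H : IsConfiguration f Y E) :
    ∃ z, omegaSet f z = ⋃ a ∈ E, omegaSet f a := by
  have := H.graph.1
  have hY := H.tower
  have hf := H.cont
  obtain ⟨n, φ, hφ, hcov⟩ := H.graph.exists_edges
  have hvfin : (⋃ i, {φ i 0, φ i 1}).Finite := finite_iUnion fun i => Set.toFinite _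
  obtain ⟨O, hO, hOcov⟩ := H.exists_regions hφ hcov
  set M : Set G := {e | (∃ a ∈ E, e ∈ omegaSet f a) ∧ e ∉ towerMinimal Y ∧
    towerFiber Y e ∩ ⋃ i, {φ i 0, φ i 1} = ∅} with hM
  have hpre : ∀ a ∈ E, ∀ p ∈ omegaSet f a, p ∉ towerMinimal Y → ∃ j, ∃ e ∈ M, f^[j] e = p := by
    intro a ha p hp hpS
    obtain ⟨j, e, he, hj, hv⟩ :=
      hY.exists_preimage_fiber_inter_eq_empty hf hvfin (H.attracted a ha) hp
    refine ⟨j, e, ⟨⟨a, ha, he⟩, fun heS => hpS ?_, hv⟩, hj⟩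
    rw [← hj]
    exact (hY.mapsTo_minimal H.graph hf
      (hY.omegaSet_subset_core (H.attracted a ha) he)).iterate j heS
  have : Nonempty M := by
    obtain ⟨a, ha⟩ := H.nonempty
    obtain ⟨p, hp, hpS⟩ := Set.not_subset.1 (H.not_subset a ha)
    obtain ⟨-, e, he, -⟩ := hpre a ha p hp hpS
    exact ⟨⟨e, he⟩⟩
  set e : ℕ → M := fun m => TopologicalSpace.denseSeq M (Nat.unpair m).1 with he
  obtain ⟨z, hzY, hzO, hze⟩ := H.exists_orbit hφ hcov hO (e := fun m => e m)
    (fun m => (e m).2.1) (fun m => (e m).2.2.1) (fun m => (e m).2.2.2)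
  have hzmaps := mapsTo_omegaSet hf z
  have hMz : M ⊆ omegaSet f z := by
    intro p hp
    rw [mem_omegaSet_iff]
    intro U hU hpU k
    obtain ⟨ε, hε, hball⟩ := Metric.isOpen_iff.1 hU p hpU
    obtain ⟨i, hi⟩ := (TopologicalSpace.denseRange_denseSeq M).exists_dist_lt ⟨p, hp⟩ (half_pos hε)
    obtain ⟨l, hl⟩ := exists_nat_one_div_lt (half_pos hε)
    obtain ⟨t, ht, hd⟩ := hze (Nat.pair i (max k l))
    have h1 := Nat.right_le_pair i (max k l)
    refine ⟨t, by have := le_max_left k l; omega, hball ?_⟩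
    have h2 : (l : ℝ) ≤ (Nat.pair i (max k l) : ℕ) := by
      exact_mod_cast (le_max_right k l).trans h1
    have h3 : 1 / ((Nat.pair i (max k l) : ℕ) + 1 : ℝ) ≤ 1 / ((l : ℝ) + 1) :=
      one_div_le_one_div_of_le (by positivity) (by linarith)
    simp only [he, Nat.unpair_pair] at hd
    rw [Subtype.dist_eq] at hi
    rw [Metric.mem_ball]
    have h4 := dist_triangle (f^[t] z) (TopologicalSpace.denseSeq M i : G) p
    rw [dist_comm (TopologicalSpace.denseSeq M i : G) p] at h4
    simp only at hi
    linarith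
  have hSz := hY.minimal_subset_omegaSet hzY
  have hsub : ⋃ a ∈ E, omegaSet f a ⊆ omegaSet f z := by
    refine iUnion₂_subset fun a ha p hp => ?_
    by_cases hpS : p ∈ towerMinimal Y
    · exact hSz hpS
    · obtain ⟨j, e, he, rfl⟩ := hpre a ha p hp hpS
      exact hzmaps.iterate j (hMz he)
  refine ⟨z, Subset.antisymm (fun p hp => ?_) hsub⟩
  by_contra hpF
  obtain ⟨j, r, hr, rfl, hv⟩ := hY.exists_preimage_fiber_inter_eq_empty hf hvfin hzY hp
  have hrF : r ∉ ⋃ a ∈ E, omegaSet f a := by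
    intro hrF
    obtain ⟨a, ha, hra⟩ := mem_iUnion₂.1 hrF
    exact hpF (mem_biUnion ha ((mapsTo_omegaSet hf a).iterate j hra))
  obtain ⟨i, hi⟩ := hOcov r (hY.omegaSet_subset_core hzY hr) hv
    (hY.omegaSet_inter_interior_fiber hr) hrF
  obtain ⟨k, hk⟩ := eventually_atTop.1 (hzO i)
  obtain ⟨t, ht, htO⟩ := mem_omegaSet_iff.1 hr (O i) (hO i).isOpen hi k
  exact hk t ht htO

end IsConfiguration

namespace IsCycleOfGraphs

variable {G : Type*} [TopologicalSpace G] {f : G → G} {X : Set G} {k : ℕ}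

theorem isClosed [CompactSpace G] [T2Space G] (hf : Continuous f) (h : IsCycleOfGraphs f X k) :
    IsClosed X := by
  obtain ⟨K, hK, rfl⟩ := h
  exact isClosed_biUnion_finset fun i _ =>
    (hK.1.1.isCompact.image (hf.iterate i)).isClosed

theorem mapsTo_s4 (h : IsCycleOfGraphs f X k) : MapsTo f X X := by
  obtain ⟨K, ⟨-, hk, hKk, -⟩, rfl⟩ := h
  intro q hq
  obtain ⟨i, hi, r, hr, rfl⟩ := mem_iUnion₂.1 hq
  rw [Finset.mem_range] at hi
  rw [← Function.iterate_succ_apply' f]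
  rcases eq_or_lt_of_le (Nat.succ_le_of_lt hi) with h | h
  · exact mem_iUnion₂.2 ⟨0, Finset.mem_range.2 hk, f^[i + 1] r, hKk ▸ ⟨r, hr, by rw [← h]⟩, rfl⟩
  · exact mem_iUnion₂.2 ⟨i + 1, Finset.mem_range.2 h, r, hr, rfl⟩

/-- A connected subset of a cycle of graphs does not return to itself before the period. -/
theorem iterate_notMem [CompactSpace G] [T2Space G] (hf : Continuous f)
    (h : IsCycleOfGraphs f X k) {C : Set G} (hC : IsPreconnected C) (hCX : C ⊆ X) {q : G}
    (hq : q ∈ C) {t : ℕ} (ht : 0 < t) (htk : t < k) : f^[t] q ∉ C := by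
  obtain ⟨K, ⟨hK, hk, hKk, hdisj⟩, rfl⟩ := h
  intro hqt
  have hcl (i : ℕ) : IsClosed (f^[i] '' K) := (hK.1.isCompact.image (hf.iterate i)).isClosed
  obtain ⟨i, hi, hqi⟩ := mem_iUnion₂.1 (hCX hq)
  rw [Finset.mem_range] at hi
  have hsub : C ⊆ f^[i] '' K := by
    have hcov : C ⊆ f^[i] '' K ∪ ⋃ j ∈ (Finset.range k).erase i, f^[j] '' K := by
      intro r hr
      obtain ⟨j, hj, hrj⟩ := mem_iUnion₂.1 (hCX hr)
      by_cases hji : j = i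
      · exact Or.inl (hji ▸ hrj)
      · exact Or.inr (mem_iUnion₂.2 ⟨j, Finset.mem_erase.2 ⟨hji, hj⟩, hrj⟩)
    have hd : Disjoint (f^[i] '' K) (⋃ j ∈ (Finset.range k).erase i, f^[j] '' K) := by
      simp only [disjoint_iUnion_right, Finset.mem_erase, Finset.mem_range]
      exact fun j hj => hdisj i j hi hj.2 hj.1.symm
    rcases isPreconnected_iff_subset_of_disjoint_closed.1 hC _ _ (hcl i)
      (isClosed_biUnion_finset fun j _ => hcl j) hcov
      (by rw [hd.inter_eq, inter_empty]) with h | h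
    · exact h
    · exact absurd (h hq) (disjoint_left.1 hd hqi)
  obtain ⟨r, hr, rfl⟩ := hqi
  rw [← Function.iterate_add_apply] at hqt
  rcases lt_or_ge (t + i) k with h | h
  · exact disjoint_left.1 (hdisj (t + i) i h hi (by omega)) ⟨r, hr, rfl⟩ (hsub hqt)
  · refine disjoint_left.1 (hdisj (t + i - k) i (by omega) hi (by omega)) ?_ (hsub hqt)
    exact ⟨f^[k] r, hKk ▸ mem_image_of_mem _ hr, by
      rw [← Function.iterate_add_apply, Nat.sub_add_cancel h]⟩

end IsCycleOfGraphs

theorem IsTopGraph.finite_frontier_biUnion {G ι : Type*} [MetricSpace G] (hG : IsTopGraph G)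
    {s : Set ι} (hs : s.Finite) {A : ι → Set G} (hA : ∀ i ∈ s, IsPreconnected (A i)) :
    (frontier (⋃ i ∈ s, A i)).Finite := by
  induction s, hs using Set.Finite.induction_on with
  | empty => simp
  | @insert a s _ _ ih =>
    rw [biUnion_insert]
    have h1 := hG.finite_frontier_s4 (hA a (mem_insert a s))
    have h2 := ih fun i hi => hA i (mem_insert_of_mem a hi)
    exact ((h1.inter_of_left _).union (h2.inter_of_right _)).subset (frontier_union_subset _ _)

theorem IsCycleOfGraphs.finite_frontier_s4 {G : Type*} [MetricSpace G] {f : G → G} {X : Set G} {k : ℕ}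
    (hG : IsTopGraph G) (hf : Continuous f) (h : IsCycleOfGraphs f X k) :
    (frontier X).Finite := by
  obtain ⟨K, ⟨hK, -⟩, rfl⟩ := h
  exact hG.finite_frontier_biUnion (Finset.range k).finite_toSet fun i _ =>
    hK.2.1.isPreconnected.image _ (hf.iterate i).continuousOn

/-- If an infinite orbit in `ω(u)` stays in a closed invariant set with finite frontier then the
orbit of `u` is eventually in that set. -/
theorem eventually_mem_of_finite_frontier {G : Type*} [TopologicalSpace G] {f : G → G}
    (hf : Continuous f) {X : Set G} (hX : IsClosed X) (hmaps : MapsTo f X X)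
    (hfr : (frontier X).Finite) {u p : G} (hp : p ∈ omegaSet f u) (hpX : p ∈ X)
    (hinj : Function.Injective fun j => f^[j] p) : ∀ᶠ t in atTop, f^[t] u ∈ X := by
  obtain ⟨j, hj⟩ : ∃ j, f^[j] p ∉ frontier X := by
    by_contra! hcon
    exact infinite_of_injective_forall_mem hinj hcon hfr
  have h_int : f^[j] p ∈ interior X := by
    rw [hX.frontier_eq] at hj
    by_contra h
    exact hj ⟨hmaps.iterate j hpX, h⟩
  obtain ⟨t, -, ht⟩ := mem_omegaSet_iff.1 ((mapsTo_omegaSet hf u).iterate j hp) _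
    isOpen_interior h_int 0
  refine eventually_atTop.2 ⟨t, fun s hs => ?_⟩
  have := hmaps.iterate (s - t) (interior_subset ht)
  rwa [← Function.iterate_add_apply, Nat.sub_add_cancel hs] at this

/-- The orbit of `u` visits infinitely often all the components meeting `ω(u)`. -/
theorem exists_iterate_mem_connectedComponentIn {G : Type*} [TopologicalSpace G] [CompactSpace G]
    [T2Space G] [PreconnectedSpace G] {f : G → G} {Z : Set G} (hZ : IsClosed Z)
    (hfr : (frontier Z).Finite) {u w : G} (hu : ∀ᶠ t in atTop, f^[t] u ∈ Z)
    (hw : w ∈ omegaSet f u) (T : ℕ) : ∃ t ≥ T, f^[t] u ∈ connectedComponentIn Z w := by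
  have hfin := finite_connectedComponentIn_of_finite_frontier hZ hfr
  set B := ⋃ C ∈ (connectedComponentIn Z '' Z) \ {connectedComponentIn Z w}, C with hB
  have hBcl : IsClosed B := by
    refine hfin.sdiff.isClosed_biUnion ?_
    rintro _ ⟨⟨q, -, rfl⟩, -⟩
    exact isClosed_connectedComponentIn hZ q
  have hwB : w ∈ Bᶜ := by
    intro h
    obtain ⟨_, ⟨⟨q, hq, rfl⟩, hne⟩, hwq⟩ := mem_iUnion₂.1 h
    exact hne (connectedComponentIn_eq hwq)
  obtain ⟨N, hN⟩ := eventually_atTop.1 hu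
  obtain ⟨t, ht, htB⟩ := mem_omegaSet_iff.1 hw _ hBcl.isOpen_compl hwB (max T N)
  have htZ := hN t ((le_max_right _ _).trans ht)
  refine ⟨t, (le_max_left _ _).trans ht, ?_⟩
  by_contra hcon
  refine htB (mem_iUnion₂.2 ⟨_, ⟨⟨_, htZ, rfl⟩, fun h => hcon ?_⟩, mem_connectedComponentIn htZ⟩)
  rw [← mem_singleton_iff.1 h]
  exact mem_connectedComponentIn htZ

/-- The union of the components of `Z` meeting `W`. -/
def componentsMeeting {G : Type*} [TopologicalSpace G] (Z W : Set G) : Set G :=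
  ⋃ w ∈ W, connectedComponentIn Z w

section componentsMeeting

variable {G : Type*} [TopologicalSpace G] {Z Z' W : Set G}

theorem componentsMeeting_subset : componentsMeeting Z W ⊆ Z :=
  iUnion₂_subset fun w _ => connectedComponentIn_subset Z w

theorem componentsMeeting_mono (h : Z ⊆ Z') : componentsMeeting Z W ⊆ componentsMeeting Z' W :=
  iUnion₂_mono fun w _ => connectedComponentIn_mono w h

theorem subset_componentsMeeting (h : W ⊆ Z) : W ⊆ componentsMeeting Z W := fun w hw =>
  mem_iUnion₂.2 ⟨w, hw, mem_connectedComponentIn (h hw)⟩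

theorem componentsMeeting_eq_sUnion :
    componentsMeeting Z W = ⋃ C ∈ connectedComponentIn Z '' W, C := by
  rw [biUnion_image]; rfl

theorem isClosed_componentsMeeting (hZ : IsClosed Z)
    (hfin : (connectedComponentIn Z '' Z).Finite) (hW : W ⊆ Z) :
    IsClosed (componentsMeeting Z W) := by
  rw [componentsMeeting_eq_sUnion]
  refine (hfin.subset (image_mono hW)).isClosed_biUnion ?_
  rintro _ ⟨w, -, rfl⟩
  exact isClosed_connectedComponentIn hZ w

theorem mapsTo_componentsMeeting {f : G → G} (hf : Continuous f) (hZ : MapsTo f Z Z)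
    (hW : MapsTo f W W) (hWZ : W ⊆ Z) :
    MapsTo f (componentsMeeting Z W) (componentsMeeting Z W) := by
  intro q hq
  obtain ⟨w, hw, hqw⟩ := mem_iUnion₂.1 hq
  exact mem_iUnion₂.2 ⟨f w, hW hw, connectedComponentIn_iterate_subset hf hZ
    isPreconnected_connectedComponentIn (connectedComponentIn_subset Z w) 1
    (mem_image_of_mem f (mem_connectedComponentIn (hWZ hw))) (mem_image_of_mem f hqw)⟩

theorem connectedComponentIn_subset_componentsMeeting {w : G} (hw : w ∈ W) (hWZ : W ⊆ Z) :
    connectedComponentIn Z w ⊆ connectedComponentIn (componentsMeeting Z W) w :=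
  isPreconnected_connectedComponentIn.subset_connectedComponentIn
    (mem_connectedComponentIn (hWZ hw)) (subset_iUnion₂_of_subset w hw Subset.rfl)

end componentsMeeting

/-- A solenoidal limit set determines a tower, which attracts the points whose limit sets meet
it. -/
theorem exists_isTower {G : Type*} [MetricSpace G] (hG : IsTopGraph G) {f : G → G}
    (hf : Continuous f) {x : G} (hsol : IsSolenoid f (omegaSet f x)) :
    ∃ Y, IsTower f Y ∧ ∀ u, (omegaSet f x ∩ omegaSet f u).Nonempty → IsAttracted f Y u ∧
      ∀ X k, IsCycleOfGraphs f X k → omegaSet f x ⊆ X → omegaSet f u ⊆ X := by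
  have := hG.1
  have := hG.2.1
  choose X k hk hX hxX using fun n => hsol.2 (n + 1)
  have hinj (p : G) (hp : p ∈ omegaSet f x) : Function.Injective fun j => f^[j] p := by
    have hne (i j : ℕ) (hij : i < j) : f^[i] p ≠ f^[j] p := fun he => by
      have hm := hxX (j - i) ((mapsTo_omegaSet hf x).iterate i hp)
      refine (hX (j - i)).iterate_notMem hf isPreconnected_singleton
        (singleton_subset_iff.2 hm) rfl (t := j - i) (by omega) (hk _) ?_
      rw [← Function.iterate_add_apply, Nat.sub_add_cancel hij.le]
      exact he.symm
    intro i j he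
    rcases lt_trichotomy i j with h | h | h
    · exact absurd he (hne i j h)
    · exact h
    · exact absurd he.symm (hne j i h)
  have hentry (A : Set G) (hA : IsClosed A) (hmaps : MapsTo f A A) (hfr : (frontier A).Finite)
      (hxA : omegaSet f x ⊆ A) (u : G) (hu : (omegaSet f x ∩ omegaSet f u).Nonempty) :
      ∀ᶠ t in atTop, f^[t] u ∈ A := by
    obtain ⟨p, hpx, hpu⟩ := hu
    exact eventually_mem_of_finite_frontier hf hA hmaps hfr hpu (hxA hpx) (hinj p hpx)
  set Z : ℕ → Set G := fun n => ⋂ m ≤ n, X m with hZdef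
  have hZX (n : ℕ) : Z n ⊆ X n := biInter_subset_of_mem (mem_Iic.2 le_rfl)
  have hZcl (n : ℕ) : IsClosed (Z n) := isClosed_biInter fun m _ => (hX m).isClosed hf
  have hZanti : Antitone Z := fun m n hmn => biInter_mono (fun i hi => le_trans hi hmn)
    fun _ _ => Subset.rfl
  have hZmaps (n : ℕ) : MapsTo f (Z n) (Z n) := fun q hq =>
    mem_iInter₂.2 fun m hm => (hX m).mapsTo_s4 (mem_iInter₂.1 hq m hm)
  have hZfr (n : ℕ) : (frontier (Z n)).Finite := by
    induction n with
    | zero => simpa [hZdef] using (hX 0).finite_frontier_s4 hG hf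
    | succ n ih =>
      have he : Z (n + 1) = Z n ∩ X (n + 1) := biInter_le_succ X n
      rw [he]
      exact ((ih.inter_of_left _).union
        (((hX (n + 1)).finite_frontier_s4 hG hf).inter_of_right _)).subset (frontier_inter_subset _ _)
  have hxZ (n : ℕ) : omegaSet f x ⊆ Z n := subset_iInter₂ fun m _ => hxX m
  have hxmeet : (omegaSet f x ∩ omegaSet f x).Nonempty := by
    rw [inter_self]
    exact omegaSet_nonempty x
  have hxe (n : ℕ) := hentry (Z n) (hZcl n) (hZmaps n) (hZfr n) (hxZ n) x hxmeet
  have hZfin (n : ℕ) := finite_connectedComponentIn_of_finite_frontier (hZcl n) (hZfr n)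
  have hYcl (n : ℕ) : IsClosed (componentsMeeting (Z n) (omegaSet f x)) :=
    isClosed_componentsMeeting (hZcl n) (hZfin n) (hxZ n)
  have hYmaps (n : ℕ) := mapsTo_componentsMeeting hf (hZmaps n) (mapsTo_omegaSet hf x) (hxZ n)
  refine ⟨fun n => componentsMeeting (Z n) (omegaSet f x), ⟨hYcl, fun m n hmn =>
    componentsMeeting_mono (hZanti hmn), hYmaps, fun n q hq q' hq' T => ?_,
    fun n q hq t ht htn => ?_⟩, fun u hu => ⟨fun n => ?_, fun A l hA hxA => ?_⟩⟩
  · obtain ⟨w, hw, hqw⟩ := mem_iUnion₂.1 hq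
    obtain ⟨w', hw', hqw'⟩ := mem_iUnion₂.1 hq'
    obtain ⟨τ, -, hτ⟩ := exists_iterate_mem_connectedComponentIn (hZcl n) (hZfr n) (hxe n) hw 0
    obtain ⟨τ', hτ', hτm⟩ :=
      exists_iterate_mem_connectedComponentIn (hZcl n) (hZfr n) (hxe n) hw' (τ + T)
    refine ⟨τ' - τ, by omega, ?_⟩
    have h1 : f^[τ'] x ∈ f^[τ' - τ] '' connectedComponentIn (Z n) w :=
      ⟨_, hτ, by rw [← Function.iterate_add_apply, Nat.sub_add_cancel (by omega)]⟩
    have h2 := connectedComponentIn_iterate_subset hf (hZmaps n)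
      isPreconnected_connectedComponentIn (connectedComponentIn_subset (Z n) w) _ h1
      (mem_image_of_mem _ hqw)
    rw [← connectedComponentIn_eq hτm] at h2
    have h3 := connectedComponentIn_subset_componentsMeeting hw' (hxZ n)
    rw [← connectedComponentIn_eq (h3 hqw')]
    exact h3 h2
  · exact (hX n).iterate_notMem hf isPreconnected_connectedComponentIn
      ((connectedComponentIn_subset _ _).trans (componentsMeeting_subset.trans (hZX n)))
      (mem_connectedComponentIn hq) ht (htn.trans_lt (hk n))
  · refine hentry _ (hYcl n) (hYmaps n) ?_ (subset_componentsMeeting (hxZ n)) u hu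
    rw [componentsMeeting_eq_sUnion]
    refine hG.finite_frontier_biUnion ((hZfin n).subset (image_mono (hxZ n))) ?_
    rintro _ ⟨w, -, rfl⟩
    exact isPreconnected_connectedComponentIn
  · exact omegaSet_subset_of_eventually (hA.isClosed hf)
      (hentry A (hA.isClosed hf) hA.mapsTo_s4 (hA.finite_frontier_s4 hG hf) hxA u hu)

/-- If `ω_f(x)` is a solenoid and `ω_f(x) ∩ ω_f(y) ≠ ∅`, then `ω_f(x) ∪ ω_f(y)` is
also a solenoid; in particular it is itself an ω-limit set. -/
theorem union_omegaSet_isSolenoid {G : Type*} [MetricSpace G]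
    (hG : IsTopGraph G) (f : G → G) (hf : Continuous f) (x y : G)
    (hsol : IsSolenoid f (omegaSet f x))
    (hmeet : (omegaSet f x ∩ omegaSet f y).Nonempty) :
    IsSolenoid f (omegaSet f x ∪ omegaSet f y) ∧
      ∃ z : G, omegaSet f z = omegaSet f x ∪ omegaSet f y := by
  have := hG.1
  obtain ⟨Y, hY, hatt⟩ := exists_isTower hG hf hsol
  obtain ⟨hy, hycyc⟩ := hatt y hmeet
  have hx : IsAttracted f Y x := (hatt x (by rw [inter_self]; exact omegaSet_nonempty x)).1
  refine ⟨⟨hsol.1.mono subset_union_left, fun n => ?_⟩, ?_⟩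
  · obtain ⟨X, k, hk, hX, hxX⟩ := hsol.2 n
    exact ⟨X, k, hk, hX, union_subset hxX (hycyc X k hX hxX)⟩
  by_cases hxy : omegaSet f x ⊆ omegaSet f y
  · exact ⟨y, (union_eq_self_of_subset_left hxy).symm⟩
  by_cases hyx : omegaSet f y ⊆ omegaSet f x
  · exact ⟨x, (union_eq_self_of_subset_right hyx).symm⟩
  have hnot : ∀ a ∈ ({x, y} : Set G), ¬ omegaSet f a ⊆ towerMinimal Y := by
    rintro a (rfl | rfl) h
    · exact hxy (h.trans (hY.minimal_subset_omegaSet hy))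
    · exact hyx (h.trans (hY.minimal_subset_omegaSet hx))
  have H : IsConfiguration f Y {x, y} :=
    { graph := hG
      cont := hf
      tower := hY
      finite := toFinite _
      nonempty := insert_nonempty _ _
      attracted := by rintro a (rfl | rfl) <;> assumption
      notMem_core := fun a ha t h => hnot a ha (hY.omegaSet_eq_minimal_of_iterate hG h).subset
      not_subset := hnot }
  obtain ⟨z, hz⟩ := H.exists_omegaSet_eq
  exact ⟨z, hz.trans (biUnion_pair x y _)⟩
end
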